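/- (Five skew lines on a cubic of type F₂) Let F∈ℝ[x₀,x₁,x₂,x₃] be a nonzero homogeneous cubic polynomial defining a nonsingular cubic surface (the gradient of F is nonzero at every nonzero complex zero of F) that contains exactly 15 real lines. Then any 5 pairwise skew real lines contained in this surface form a configuration that is coarse deformation equivalent to the join configuration J(12345): it is deformation equivalent either to J(12345) or to a mirror image of J(12345). -/

import Mathlib

open Submodule

abbrev V4 : Type := Fin 4 → ℝ

abbrev PLine : Type := Submodule ℝ V4

def IsLine (P : PLine) : Prop := Module.finrank ℝ P = 2

def Skew (P Q : PLine) : Prop := IsLine P ∧ IsLine Q ∧ P ⊓ Q = ⊥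

def PairwiseSkew {n : ℕ} (L : Fin n → PLine) : Prop :=
  ∀ i j : Fin n, i ≠ j → Skew (L i) (L j)

noncomputable def det2 (a b c d : V4) : ℝ := Matrix.det (Matrix.of ![a, b, c, d])

open Classical in
noncomputable def lk (P Q R : PLine) : ℝ :=
  if h : ∃ v : Fin 6 → V4,
      P = span ℝ {v 0, v 1} ∧ Q = span ℝ {v 2, v 3} ∧ R = span ℝ {v 4, v 5} then
    Real.sign (det2 (h.choose 0) (h.choose 1) (h.choose 2) (h.choose 3) *
      det2 (h.choose 0) (h.choose 1) (h.choose 4) (h.choose 5) *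
      det2 (h.choose 2) (h.choose 3) (h.choose 4) (h.choose 5))
  else 0

noncomputable def sgnOf {n : ℕ} (L : Fin n → PLine) : ℝ :=
  ∑ i : Fin n, ∑ j : Fin n, ∑ k : Fin n,
    if i < j ∧ j < k then lk (L i) (L j) (L k) else 0

def ContinuousLineFamily (L : ℝ → PLine) : Prop :=
  ∃ v w : ℝ → V4, ContinuousOn v (Set.Icc 0 1) ∧ ContinuousOn w (Set.Icc 0 1) ∧
    ∀ t ∈ Set.Icc (0:ℝ) 1, L t = span ℝ {v t, w t}

def Deformation {n : ℕ} (L L' : Fin n → PLine) : Prop :=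
  ∃ F : ℝ → Fin n → PLine,
    (∀ i, ContinuousLineFamily (fun t => F t i)) ∧
    (∀ t ∈ Set.Icc (0:ℝ) 1, PairwiseSkew (F t)) ∧
    F 0 = L ∧ F 1 = L'

def DeformEquiv {n : ℕ} (L L' : Fin n → PLine) : Prop :=
  ∃ π π' : Equiv.Perm (Fin n), Deformation (L ∘ π) (L' ∘ π')

def IsMirror {n : ℕ} (L L' : Fin n → PLine) : Prop :=
  ∃ A : V4 →ₗ[ℝ] V4, LinearMap.det A < 0 ∧ ∀ i, L' i = (L i).map A

def CoarseDeformEquiv {n : ℕ} (L L' : Fin n → PLine) : Prop :=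
  DeformEquiv L L' ∨ ∃ M : Fin n → PLine, IsMirror L' M ∧ DeformEquiv L M

noncomputable def joinConfig {n : ℕ} (σ : Equiv.Perm (Fin n)) : Fin n → PLine :=
  fun i => span ℝ {![1, (i.val : ℝ) + 1, 0, 0], ![0, 0, ((σ i).val : ℝ) + 1, 1]}

def IsSchlafliSix (L : Fin 6 → PLine) : Prop :=
  PairwiseSkew L ∧
  ∃ F : MvPolynomial (Fin 4) ℝ,
    F ≠ 0 ∧ F.IsHomogeneous 3 ∧
    (∀ i : Fin 6, ∀ x ∈ L i, MvPolynomial.eval x F = 0) ∧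
    (∀ z : Fin 4 → ℂ, z ≠ 0 →
      MvPolynomial.eval z (MvPolynomial.map (algebraMap ℝ ℂ) F) = 0 →
      ∃ j : Fin 4, MvPolynomial.eval z (MvPolynomial.map (algebraMap ℝ ℂ) (MvPolynomial.pderiv j F)) ≠ 0)

def Reducible {n : ℕ} (L : Fin n → PLine) : Prop :=
  ∃ i j : Fin n, i ≠ j ∧ ∃ F : ℝ → Fin n → PLine,
    (∀ k, ContinuousLineFamily (fun t => F t k)) ∧
    F 0 = L ∧
    (∀ t ∈ Set.Ico (0:ℝ) 1, PairwiseSkew (F t)) ∧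
    F 1 i = F 1 j ∧
    (∀ k l : Fin n, k ≠ l → ¬(k = i ∧ l = j) → ¬(k = j ∧ l = i) → Skew (F 1 k) (F 1 l))

/-- Symmetry of a trilinear form. -/
def IsSymmTrilinear {K V : Type*} [Field K] [AddCommGroup V] [Module K V]
    (B : V →ₗ[K] V →ₗ[K] V →ₗ[K] K) : Prop :=
  (∀ x y z, B x y z = B y x z) ∧ ∀ x y z, B x y z = B x z y

/-- The cubic form `v ↦ B v v v` vanishes on the span of `x` and `y`. -/
def VanishesOn {K V : Type*} [Field K] [AddCommGroup V] [Module K V]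
    (B : V →ₗ[K] V →ₗ[K] V →ₗ[K] K) (x y : V) : Prop :=
  B x x x = 0 ∧ B x x y = 0 ∧ B x y y = 0 ∧ B y y y = 0

section Trilinear

variable {K V : Type*} [Field K] [AddCommGroup V] [Module K V]
  {B : V →ₗ[K] V →ₗ[K] V →ₗ[K] K}

theorem VanishesOn.comb (hB : IsSymmTrilinear B) {x y : V} (h : VanishesOn B x y)
    (s t u v : K) : VanishesOn B (s • x + t • y) (u • x + v • y) := by
  obtain ⟨h1, h2, h3, h4⟩ := h
  have e1 : ∀ z, B y x z = B x y z := fun z => hB.1 y x z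
  have e2 : ∀ z, B z y x = B z x y := fun z => hB.2 z y x
  refine ⟨?_, ?_, ?_, ?_⟩ <;>
    simp [e1, e2, h1, h2, h3, h4]

theorem VanishesOn.of_forall [CharZero K] (hB : IsSymmTrilinear B) {x y : V}
    (h : ∀ s t : K, B (s • x + t • y) (s • x + t • y) (s • x + t • y) = 0) :
    VanishesOn B x y := by
  have e1 : ∀ z, B y x z = B x y z := fun z => hB.1 y x z
  have e2 : ∀ z, B z y x = B z x y := fun z => hB.2 z y x
  have h10 := h 1 0
  have h01 := h 0 1
  have h11 := h 1 1
  have h12 := h 1 (-1)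
  simp [e1, e2] at h10 h01 h11 h12
  refine ⟨h10, ?_, ?_, h01⟩
  · have h6 : (6 : K) ≠ 0 := by norm_num
    refine (mul_eq_zero.1 ?_).resolve_left h6
    linear_combination h11 - h12 - 2 * h01
  · have h6 : (6 : K) ≠ 0 := by norm_num
    refine (mul_eq_zero.1 ?_).resolve_left h6
    linear_combination h11 + h12 - 2 * h10

/-- A cubic form vanishing at four points of a line vanishes on the line. -/
theorem VanishesOn.of_four_points [CharZero K] (hB : IsSymmTrilinear B) {x y : V} {l : K}
    (hl0 : l ≠ 0) (hl1 : l ≠ 1) (hx : B x x x = 0) (hy : B y y y = 0)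
    (h1 : B (x + y) (x + y) (x + y) = 0)
    (hl : B (x + l • y) (x + l • y) (x + l • y) = 0) : VanishesOn B x y := by
  have e1 : ∀ z, B y x z = B x y z := fun z => hB.1 y x z
  have e2 : ∀ z, B z y x = B z x y := fun z => hB.2 z y x
  simp [e1, e2, hx, hy] at h1 hl
  have h3 : (3 : K) ≠ 0 := by norm_num
  have hxyy : B x y y = 0 := by
    have : (3 * l * (l - 1)) * B x y y = 0 := by linear_combination hl - l * h1
    exact (mul_eq_zero.1 this).resolve_left
      (mul_ne_zero (mul_ne_zero h3 hl0) (sub_ne_zero.2 hl1))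
  refine ⟨hx, ?_, hxyy, hy⟩
  refine (mul_eq_zero.1 ?_).resolve_left h3
  rw [hxyy] at h1
  linear_combination h1

theorem linear_system_elimination {A B C D l m p q r s : K} (hlm : l - m ≠ 0)
    (h0 : (l ^ 2 - l) * A + ((l - m) * p - l + l * m) * B + (l - m) * r * D = 0)
    (h1 : (m - l) * q * A + ((m - l) * s - m + l * m) * C + (m ^ 2 - m) * D = 0)
    (h2 : (p ^ 2 - p + q * r) * (A + B) + r * (p + s - 1) * (C + D) = 0)
    (h3 : q * (p + s - 1) * (A + B) + (s ^ 2 - s + q * r) * (C + D) = 0)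
    (hd0 : p * s - q * r ≠ 0) (hd1 : (p - 1) * (s - 1) - q * r ≠ 0)
    (hdl : (p - l) * (s - m) - q * r ≠ 0) : A = 0 ∧ B = 0 ∧ C = 0 ∧ D = 0 := by
  have hAB : A + B = 0 := by
    refine (mul_eq_zero.1 ?_).resolve_left (mul_ne_zero hd0 hd1)
    linear_combination (s ^ 2 - s + q * r) * h2 - r * (p + s - 1) * h3
  have hCD : C + D = 0 := by
    refine (mul_eq_zero.1 ?_).resolve_left (mul_ne_zero hd0 hd1)
    linear_combination (p ^ 2 - p + q * r) * h3 - q * (p + s - 1) * h2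
  have hB : B = -A := by linear_combination hAB
  have hC : C = -D := by linear_combination hCD
  subst hB hC
  have h4 : (l - p) * A + r * D = 0 := by
    refine (mul_eq_zero.1 ?_).resolve_left hlm
    linear_combination h0
  have h5 : q * A + (s - m) * -D = 0 := by
    refine (mul_eq_zero.1 ?_).resolve_left hlm
    linear_combination - h1
  have hA : A = 0 := by
    refine (mul_eq_zero.1 ?_).resolve_left hdl
    linear_combination (m - s) * h4 - r * h5
  have hD : D = 0 := by
    refine (mul_eq_zero.1 ?_).resolve_left hdl
    linear_combination (l - p) * h5 - q * h4
  simp [hA, hD]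

/-- The cubic forms vanishing on the graphs of `0`, `∞`, `1`, `diag (l, m)` and of a matrix
without common eigenvector with `diag (l, m)` are zero. -/
theorem cubic_eq_zero_of_five_graphs [CharZero K] (hB : IsSymmTrilinear B)
    {a₁ a₂ b₁ b₂ : V} {l m p q r s : K}
    (hl0 : l ≠ 0) (hl1 : l ≠ 1) (hm0 : m ≠ 0) (hm1 : m ≠ 1) (hlm : l - m ≠ 0)
    (hq : q ≠ 0) (hr : r ≠ 0)
    (hd0 : p * s - q * r ≠ 0) (hd1 : (p - 1) * (s - 1) - q * r ≠ 0)
    (hdl : (p - l) * (s - m) - q * r ≠ 0)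
    (h0 : VanishesOn B a₁ a₂) (h1 : VanishesOn B b₁ b₂) (h2 : VanishesOn B (a₁ + b₁) (a₂ + b₂))
    (h3 : VanishesOn B (a₁ + l • b₁) (a₂ + m • b₂))
    (h4 : VanishesOn B (a₁ + (p • b₁ + r • b₂)) (a₂ + (q • b₁ + s • b₂))) (v : V)
    (hv : v ∈ span K {a₁, a₂, b₁, b₂}) : B v v v = 0 := by
  obtain ⟨h11, h12, h13, h14⟩ := VanishesOn.of_four_points hB hl0 hl1 h0.1 h1.1 h2.1 h3.1
  obtain ⟨h21, h22, h23, h24⟩ := VanishesOn.of_four_points hB hm0 hm1 h0.2.2.2 h1.2.2.2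
    h2.2.2.2 h3.2.2.2
  have e1 : ∀ z, B a₂ a₁ z = B a₁ a₂ z := fun z => hB.1 _ _ z
  have e2 : ∀ z, B b₁ a₁ z = B a₁ b₁ z := fun z => hB.1 _ _ z
  have e3 : ∀ z, B b₂ a₁ z = B a₁ b₂ z := fun z => hB.1 _ _ z
  have e4 : ∀ z, B b₁ a₂ z = B a₂ b₁ z := fun z => hB.1 _ _ z
  have e5 : ∀ z, B b₂ a₂ z = B a₂ b₂ z := fun z => hB.1 _ _ z
  have e6 : ∀ z, B b₂ b₁ z = B b₁ b₂ z := fun z => hB.1 _ _ z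
  have f1 : ∀ z, B z a₂ a₁ = B z a₁ a₂ := fun z => hB.2 z _ _
  have f2 : ∀ z, B z b₁ a₁ = B z a₁ b₁ := fun z => hB.2 z _ _
  have f3 : ∀ z, B z b₂ a₁ = B z a₁ b₂ := fun z => hB.2 z _ _
  have f4 : ∀ z, B z b₁ a₂ = B z a₂ b₁ := fun z => hB.2 z _ _
  have f5 : ∀ z, B z b₂ a₂ = B z a₂ b₂ := fun z => hB.2 z _ _
  have f6 : ∀ z, B z b₂ b₁ = B z b₁ b₂ := fun z => hB.2 z _ _
  obtain ⟨-, h0b, h0c, -⟩ := h0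
  obtain ⟨-, h1b, h1c, -⟩ := h1
  obtain ⟨-, h2b, h2c, -⟩ := h2
  obtain ⟨-, h3b, h3c, -⟩ := h3
  obtain ⟨h4a, h4b, h4c, h4d⟩ := h4
  simp only [map_add, map_smul, LinearMap.add_apply, LinearMap.smul_apply, smul_eq_mul,
    e2, e3, e4, e5, e6, f2, f3, f4, f5, f6, h0b, h0c, h1b, h1c, h11, h12, h13, h14,
    h21, h22, h23, h24, mul_zero, add_zero, zero_add] at h2b h2c h3b h3c h4a h4b h4c h4d
  have ea : B a₁ a₁ b₂ = - (2 * B a₁ b₁ b₂ * p + B a₁ b₂ b₂ * r) := by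
    have h3 : (3 : K) ≠ 0 := by norm_num
    refine mul_left_cancel₀ (mul_ne_zero h3 hr) ?_
    linear_combination h4a
  have ed : B a₂ a₂ b₁ = - (B a₂ b₁ b₁ * q + 2 * B a₂ b₁ b₂ * s) := by
    have h3 : (3 : K) ≠ 0 := by norm_num
    refine mul_left_cancel₀ (mul_ne_zero h3 hq) ?_
    linear_combination h4d
  have eb : 2 * B a₁ a₂ b₁ = - B a₁ a₁ b₂ - B a₂ b₁ b₁ - 2 * B a₁ b₁ b₂ := by
    linear_combination h2b
  have ec : 2 * B a₁ a₂ b₂ = - B a₂ a₂ b₁ - B a₁ b₂ b₂ - 2 * B a₂ b₁ b₂ := by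
    linear_combination h2c
  obtain ⟨zA, zB, zC, zD⟩ := linear_system_elimination (A := B a₂ b₁ b₁) (B := 2 * B a₁ b₁ b₂)
    (C := 2 * B a₂ b₁ b₂) (D := B a₁ b₂ b₂) (l := l) (m := m) (p := p) (q := q) (r := r) (s := s)
    hlm
    (by linear_combination h3b + (l - m) * ea - l * eb)
    (by linear_combination h3c + (m - l) * ed - m * ec)
    (by linear_combination h4b - p * eb - r * ec - (s - p) * ea + r * ed)
    (by linear_combination h4c - q * eb - s * ec - (p - s) * ed + q * ea)
    hd0 hd1 hdl
  have h2 : (2 : K) ≠ 0 := two_ne_zero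
  simp only [mul_eq_zero, h2, false_or] at zB zC
  simp only [zA, zB, zC, zD, mul_zero, zero_mul, add_zero, neg_zero, sub_zero] at ea ed eb ec
  simp only [ea, ed, neg_zero, mul_eq_zero, h2, false_or] at eb ec
  simp only [Submodule.mem_span_insert, Submodule.mem_span_singleton] at hv
  obtain ⟨x1, -, ⟨x2, -, ⟨y1, -, ⟨y2, rfl⟩, rfl⟩, rfl⟩, rfl⟩ := hv
  simp only [map_add, map_smul, LinearMap.add_apply, LinearMap.smul_apply, smul_eq_mul,
    e1, e2, e3, e4, e5, e6, f1, f2, f3, f4, f5, f6, h0b, h0c, h1b, h1c, h11, h12, h13, h14,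
    h21, h22, h23, h24, mul_zero, add_zero, ea, ed, eb, ec, zA, zB, zC, zD]

end Trilinear

section Polarization

open MvPolynomial

variable {K : Type*} [Field K]

theorem MvPolynomial.pderiv_pderiv_comm {σ R : Type*} [CommRing R] (i j : σ)
    (F : MvPolynomial σ R) : pderiv i (pderiv j F) = pderiv j (pderiv i F) := by
  have h : ⁅(pderiv i : Derivation R (MvPolynomial σ R) (MvPolynomial σ R)),
      (pderiv j : Derivation R (MvPolynomial σ R) (MvPolynomial σ R))⁆ = 0 := by
    classical
    refine MvPolynomial.derivation_ext fun k => ?_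
    rw [Derivation.commutator_apply, pderiv_X, pderiv_X]
    simp only [Pi.single_apply]
    split_ifs <;> simp
  have := congrArg (fun D => D F) h
  rwa [Derivation.commutator_apply, Derivation.zero_apply, sub_eq_zero] at this

/-- The symmetric trilinear form given by the third derivatives of a cubic form `F`. -/
noncomputable def polarForm (F : MvPolynomial (Fin 4) K) :
    (Fin 4 → K) →ₗ[K] (Fin 4 → K) →ₗ[K] (Fin 4 → K) →ₗ[K] K :=
  ∑ i, ∑ j, ∑ k, constantCoeff (pderiv i (pderiv j (pderiv k F))) •
    (LinearMap.proj i).smulRight ((LinearMap.proj j : (Fin 4 → K) →ₗ[K] K).smulRight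
      (LinearMap.proj k : (Fin 4 → K) →ₗ[K] K))

theorem polarForm_apply (F : MvPolynomial (Fin 4) K) (x y z : Fin 4 → K) :
    polarForm F x y z =
      ∑ i, ∑ j, ∑ k, constantCoeff (pderiv i (pderiv j (pderiv k F))) * (x i * y j * z k) := by
  simp only [polarForm, LinearMap.sum_apply, LinearMap.smul_apply, LinearMap.smulRight_apply,
    LinearMap.proj_apply, smul_eq_mul, mul_assoc]

theorem polarForm_isSymmTrilinear (F : MvPolynomial (Fin 4) K) :
    IsSymmTrilinear (polarForm F) := by
  refine ⟨fun x y z => ?_, fun x y z => ?_⟩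
  · simp only [polarForm_apply]
    rw [Finset.sum_comm]
    refine Finset.sum_congr rfl fun i _ => Finset.sum_congr rfl fun j _ =>
      Finset.sum_congr rfl fun k _ => ?_
    rw [pderiv_pderiv_comm, mul_comm (x j)]
  · simp only [polarForm_apply]
    refine Finset.sum_congr rfl fun i _ => ?_
    rw [Finset.sum_comm]
    refine Finset.sum_congr rfl fun j _ => Finset.sum_congr rfl fun k _ => ?_
    rw [pderiv_pderiv_comm k j, mul_right_comm]

theorem polarForm_self_right {F : MvPolynomial (Fin 4) K} (hF : F.IsHomogeneous 3)
    (x z : Fin 4 → K) : polarForm F x x z = 2 * ∑ k, eval x (pderiv k F) * z k := by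
  have h1 : ∀ k, ∑ j, x j * eval x (pderiv j (pderiv k F)) = 2 * eval x (pderiv k F) := by
    intro k
    have := congrArg (eval x) (IsHomogeneous.sum_X_mul_pderiv (hF.pderiv (i := k)))
    simpa using this
  have h2 : ∀ j k, ∑ i, x i * constantCoeff (pderiv i (pderiv j (pderiv k F))) =
      eval x (pderiv j (pderiv k F)) := by
    intro j k
    have h := (hF.pderiv (i := k)).pderiv (i := j)
    have := congrArg (eval x) (IsHomogeneous.sum_X_mul_pderiv h)
    simp only [Nat.add_one_sub_one, map_sum, map_mul, eval_X, one_smul] at this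
    rw [← this]
    refine Finset.sum_congr rfl fun i _ => ?_
    have h0 : (pderiv i (pderiv j (pderiv k F))).IsHomogeneous 0 := h.pderiv
    rw [← totalDegree_zero_iff_isHomogeneous, totalDegree_eq_zero_iff_eq_C] at h0
    conv_rhs => rw [h0]
    rw [eval_C, constantCoeff_eq]
  rw [polarForm_apply, Finset.mul_sum, Finset.sum_congr rfl fun i _ => Finset.sum_comm,
    Finset.sum_comm]
  refine Finset.sum_congr rfl fun k _ => ?_
  rw [← mul_assoc, ← h1, Finset.sum_mul, Finset.sum_comm]
  refine Finset.sum_congr rfl fun j _ => ?_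
  rw [← h2, Finset.mul_sum, Finset.sum_mul]
  refine Finset.sum_congr rfl fun i _ => ?_
  ring

theorem polarForm_self {F : MvPolynomial (Fin 4) K} (hF : F.IsHomogeneous 3)
    (x : Fin 4 → K) : polarForm F x x x = 6 * eval x F := by
  have := congrArg (eval x) (IsHomogeneous.sum_X_mul_pderiv hF)
  simp only [map_sum, map_mul, eval_X, nsmul_eq_mul, Nat.cast_ofNat] at this
  rw [polarForm_self_right hF, Finset.sum_congr rfl fun k _ => mul_comm _ (x k), this,
    eval_ofNat]
  ring

/-- The inclusion of the real vectors into the complex ones. -/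
noncomputable def complexify : V4 →ₗ[ℝ] (Fin 4 → ℂ) :=
  Complex.ofRealCLM.toLinearMap.compLeft (Fin 4)

@[simp] theorem complexify_apply (x : V4) (i : Fin 4) : complexify x i = (x i : ℂ) := rfl

theorem polarForm_complexify (F : MvPolynomial (Fin 4) ℝ) (x y z : V4) :
    polarForm (map (algebraMap ℝ ℂ) F) (complexify x) (complexify y) (complexify z) =
      (polarForm F x y z : ℂ) := by
  simp only [polarForm_apply, pderiv_map, constantCoeff_map, complexify_apply]
  push_cast
  rfl

/-- A real trilinear form has no complex singular point `u + i w`. -/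
def Nonsingular (B : V4 →ₗ[ℝ] V4 →ₗ[ℝ] V4 →ₗ[ℝ] ℝ) : Prop :=
  ∀ u w : V4, (∀ v, B u u v = B w w v) → (∀ v, B u w v = 0) → u = 0 ∧ w = 0

theorem nonsingular_polarForm {F : MvPolynomial (Fin 4) ℝ} (hF : F.IsHomogeneous 3)
    (hns : ∀ z : Fin 4 → ℂ, z ≠ 0 → eval z (map (algebraMap ℝ ℂ) F) = 0 →
      ∃ j : Fin 4, eval z (map (algebraMap ℝ ℂ) (pderiv j F)) ≠ 0) :
    Nonsingular (polarForm F) := by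
  intro u w huw h0
  set z : Fin 4 → ℂ := complexify u + Complex.I • complexify w with hz
  have hFc := hF.map (algebraMap ℝ ℂ)
  have hsym := polarForm_isSymmTrilinear (map (algebraMap ℝ ℂ) F)
  have hzz : ∀ v : V4, polarForm (map (algebraMap ℝ ℂ) F) z z (complexify v) = 0 := by
    intro v
    simp only [hz, map_add, map_smul, LinearMap.add_apply, LinearMap.smul_apply,
      polarForm_complexify, smul_eq_mul, hsym.1 (complexify w) (complexify u), huw v, h0 v]
    linear_combination (polarForm F w w v : ℂ) * Complex.I_mul_I +
      2 * Complex.I * Complex.ofReal_zero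
  have hj : ∀ j, eval z (map (algebraMap ℝ ℂ) (pderiv j F)) = 0 := by
    intro j
    have := hzz (Pi.single j 1)
    rw [polarForm_self_right hFc] at this
    simpa [Pi.single_apply, pderiv_map, apply_ite Complex.ofReal] using this
  have hz0 : z = 0 := by
    by_contra hne
    have he : eval z (map (algebraMap ℝ ℂ) F) = 0 := by
      have h6 := polarForm_self hFc z
      rw [polarForm_self_right hFc] at h6
      simpa [pderiv_map, hj] using h6
    obtain ⟨j, hj'⟩ := hns z hne he
    exact hj' (hj j)
  have hi : ∀ i, u i = 0 ∧ w i = 0 := by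
    intro i
    have := congrFun hz0 i
    simpa [hz, Complex.ext_iff] using this
  exact ⟨funext fun i => (hi i).1, funext fun i => (hi i).2⟩

end Polarization

section Lines

variable {B : V4 →ₗ[ℝ] V4 →ₗ[ℝ] V4 →ₗ[ℝ] ℝ}

/-- `P` is a line on the cubic surface `B v v v = 0`. -/
def LiesOn (B : V4 →ₗ[ℝ] V4 →ₗ[ℝ] V4 →ₗ[ℝ] ℝ) (P : PLine) : Prop :=
  IsLine P ∧ ∀ x ∈ P, B x x x = 0

def Meets (P Q : PLine) : Prop := P ⊓ Q ≠ ⊥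

theorem Meets.symm {P Q : PLine} (h : Meets P Q) : Meets Q P := by
  rwa [Meets, inf_comm]

theorem meets_iff {P Q : PLine} : Meets P Q ↔ ∃ x ∈ P, x ∈ Q ∧ x ≠ 0 := by
  simp only [Meets, Submodule.ne_bot_iff, Submodule.mem_inf, and_assoc]

theorem IsLine.meets_self {P : PLine} (h : IsLine P) : Meets P P := by
  rw [Meets, inf_idem]
  rintro rfl
  simp [IsLine] at h

theorem isLine_span_pair {u v : V4} (h : LinearIndependent ℝ ![u, v]) :
    IsLine (span ℝ {u, v}) := by
  have hr : Set.range ![u, v] = {u, v} := by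
    ext
    simp [eq_comm, or_comm]
  rw [IsLine, ← hr, finrank_span_eq_card h, Fintype.card_fin]

theorem IsLine.eq_span_pair {P : PLine} (h : IsLine P) {x y : V4} (hx : x ∈ P) (hy : y ∈ P)
    (hxy : LinearIndependent ℝ ![x, y]) : P = span ℝ {x, y} := by
  refine (Submodule.eq_of_le_of_finrank_eq (span_le.2 ?_) ?_).symm
  · rintro z (rfl | rfl) <;> assumption
  · rw [isLine_span_pair hxy, h]

theorem IsLine.exists_basis {P : PLine} (h : IsLine P) {x : V4} (hx : x ∈ P) (hx0 : x ≠ 0) :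
    ∃ y ∈ P, LinearIndependent ℝ ![x, y] ∧ P = span ℝ {x, y} := by
  have hlt : ¬ P ≤ span ℝ {x} := by
    intro hle
    have := Submodule.finrank_mono hle
    rw [h, finrank_span_singleton hx0] at this
    omega
  obtain ⟨y, hy, hyx⟩ := Set.not_subset.1 hlt
  have hxy : LinearIndependent ℝ ![x, y] := by
    rw [LinearIndependent.pair_iff' hx0]
    intro a ha
    exact hyx (mem_span_singleton.2 ⟨a, ha⟩)
  exact ⟨y, hy, hxy, h.eq_span_pair hx hy hxy⟩

theorem IsLine.eq_of_le {P Q : PLine} (hP : IsLine P) (hQ : IsLine Q) (h : P ≤ Q) : P = Q :=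
  Submodule.eq_of_le_of_finrank_eq h (by rw [hP, hQ])

theorem IsLine.finrank_sup {P Q : PLine} (hP : IsLine P) (hQ : IsLine Q) (hne : P ≠ Q)
    (h : Meets P Q) : Module.finrank ℝ (P ⊔ Q : PLine) = 3 := by
  have h1 := Submodule.finrank_sup_add_finrank_inf_eq P Q
  rw [hP, hQ] at h1
  have h2 : Module.finrank ℝ (P ⊓ Q : PLine) ≠ 0 := fun h0 => h (Submodule.finrank_eq_zero.1 h0)
  have h3 : Module.finrank ℝ (P ⊓ Q : PLine) < 2 := by
    rw [← hP]
    refine Submodule.finrank_lt_finrank_of_lt (lt_of_le_of_ne inf_le_left fun he => hne ?_)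
    exact hP.eq_of_le hQ (inf_eq_left.1 he)
  omega

theorem meets_of_le_sup {P Q X Y : PLine} (hP : IsLine P) (hQ : IsLine Q) (hne : P ≠ Q)
    (h : Meets P Q) (hX : IsLine X) (hY : IsLine Y) (hXW : X ≤ P ⊔ Q) (hYW : Y ≤ P ⊔ Q) :
    Meets X Y := by
  intro h0
  have h1 := Submodule.finrank_sup_add_finrank_inf_eq X Y
  rw [hX, hY, h0, finrank_bot] at h1
  have h2 := Submodule.finrank_mono (sup_le hXW hYW)
  rw [hP.finrank_sup hQ hne h] at h2
  omega

theorem LiesOn.vanishesOn (hB : IsSymmTrilinear B) {P : PLine} (h : LiesOn B P) {x y : V4}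
    (hx : x ∈ P) (hy : y ∈ P) : VanishesOn B x y :=
  VanishesOn.of_forall hB fun s t => h.2 _ (P.add_mem (P.smul_mem s hx) (P.smul_mem t hy))

theorem VanishesOn.liesOn (hB : IsSymmTrilinear B) {x y : V4} (h : VanishesOn B x y)
    (hxy : LinearIndependent ℝ ![x, y]) : LiesOn B (span ℝ {x, y}) := by
  refine ⟨isLine_span_pair hxy, fun z hz => ?_⟩
  obtain ⟨s, t, rfl⟩ := mem_span_pair.1 hz
  exact (h.comb hB s t 0 0).1

/-- A nonsingular cubic surface has no line along which the tangent plane is constant. -/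
theorem Nonsingular.not_constant_tangent (hns : Nonsingular B) (hB : IsSymmTrilinear B)
    {a b : V4} (hab : LinearIndependent ℝ ![a, b]) (h : V4 → ℝ) {g₁ g₂ g₃ : ℝ}
    (h1 : ∀ v, B a a v = g₁ * h v) (h2 : ∀ v, B a b v = g₂ * h v)
    (h3 : ∀ v, B b b v = g₃ * h v) : False := by
  have h2' : ∀ v, B b a v = g₂ * h v := fun v => by rw [hB.1, h2]
  rw [LinearIndependent.pair_iff] at hab
  by_cases hg : g₁ = 0
  · have := (hns a 0 (fun v => by simp [h1, hg]) (fun v => by simp)).1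
    simpa using hab 1 0 (by simp [this])
  set D := (g₂ ^ 2 - g₁ * g₃) / g₁ ^ 2 with hD
  have hu : ∀ x : ℝ, x • a + b = 0 → False := fun x hx => by
    simpa using hab x 1 (by simpa using hx)
  rcases le_or_gt 0 D with hD0 | hD0
  · refine hu _ (hns ((-g₂ / g₁ + √D) • a + b) 0 (fun v => ?_) (fun v => by simp)).1
    have hs := Real.sq_sqrt hD0
    simp only [map_add, map_smul, LinearMap.add_apply, LinearMap.smul_apply, smul_eq_mul,
      h1, h2, h2', h3, map_zero, LinearMap.zero_apply]
    rw [hD] at hs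
    field_simp at hs ⊢
    linear_combination h v * hs
  · refine hu _ (hns ((-g₂ / g₁) • a + b) (√(-D) • a) (fun v => ?_) (fun v => ?_)).1
    · have hs := Real.sq_sqrt (neg_nonneg.2 hD0.le)
      simp only [map_add, map_smul, LinearMap.add_apply, LinearMap.smul_apply, smul_eq_mul,
        h1, h2, h2', h3]
      have hs' : √(-D) * (√(-D) * (g₁ * h v)) = -D * (g₁ * h v) := by
        linear_combination (g₁ * h v) * hs
      rw [hs', hD]
      field_simp
      ring
    · simp only [map_add, map_smul, LinearMap.add_apply, LinearMap.smul_apply, smul_eq_mul,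
        h1, h2']
      field_simp
      ring

/-- Two functionals vanishing on a common hyperplane are proportional. -/
theorem exists_functional_of_finrank_eq_three {W : PLine} (hW : Module.finrank ℝ W = 3) :
    ∃ h : V4 → ℝ, ∀ φ : V4 →ₗ[ℝ] ℝ, W ≤ LinearMap.ker φ → ∃ g : ℝ, ∀ v, φ v = g * h v := by
  have hlt : W < ⊤ := lt_top_iff_ne_top.2 fun h => by
    rw [h, finrank_top] at hW
    simp at hW
  obtain ⟨h, h0, hle⟩ := Submodule.exists_le_ker_of_lt_top W hlt
  have hker : W = LinearMap.ker h := by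
    refine Submodule.eq_of_le_of_finrank_eq hle ?_
    have h1 := LinearMap.finrank_range_add_finrank_ker h
    rw [LinearMap.range_eq_top.2 (LinearMap.surjective h0)] at h1
    simp at h1
    omega
  obtain ⟨d, hd⟩ := LinearMap.surjective h0 1
  refine ⟨h, fun φ hφ => ⟨φ d, fun v => ?_⟩⟩
  have : v - h v • d ∈ W := by
    rw [hker]
    simp [hd]
  have := hφ this
  simp only [LinearMap.mem_ker, map_sub, map_smul, smul_eq_mul] at this
  linear_combination this

/-- The plane spanned by two lines of a nonsingular cubic surface contains a third line. -/
theorem Nonsingular.exists_third_line (hns : Nonsingular B) (hB : IsSymmTrilinear B)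
    {P Q : PLine} (hP : LiesOn B P) (hQ : LiesOn B Q) (hne : P ≠ Q) (hm : Meets P Q) :
    ∃ R : PLine, LiesOn B R ∧ R ≤ P ⊔ Q ∧ R ≠ P ∧ R ≠ Q := by
  have hW := hP.1.finrank_sup hQ.1 hne hm
  obtain ⟨a, haP, haQ, ha0⟩ := meets_iff.1 hm
  obtain ⟨b, hbP, hab, hPs⟩ := hP.1.exists_basis haP ha0
  obtain ⟨c, hcQ, hac, hQs⟩ := hQ.1.exists_basis haQ ha0
  have hcP : c ∉ P := fun hc => hne ((hP.1.eq_span_pair haP hc hac).trans hQs.symm)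
  have hbQ : b ∉ Q := fun hb => hne (hPs.trans (hQ.1.eq_span_pair haQ hb hab).symm)
  obtain ⟨h, hh⟩ := exists_functional_of_finrank_eq_three hW
  have hWle : ∀ φ : V4 →ₗ[ℝ] ℝ, φ a = 0 → φ b = 0 → φ c = 0 → P ⊔ Q ≤ LinearMap.ker φ := by
    intro φ h1 h2 h3
    rw [hPs, hQs]
    refine sup_le (span_le.2 ?_) (span_le.2 ?_) <;> rintro z (rfl | rfl) <;> assumption
  obtain ⟨aaa, aab, abb, bbb⟩ := hP.vanishesOn hB haP hbP
  obtain ⟨-, aac, acc, ccc⟩ := hQ.vanishesOn hB haQ hcQ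
  have e1 : ∀ z, B b a z = B a b z := fun z => hB.1 _ _ z
  have e2 : ∀ z, B c a z = B a c z := fun z => hB.1 _ _ z
  have e3 : ∀ z, B c b z = B b c z := fun z => hB.1 _ _ z
  have f1 : ∀ z, B z b a = B z a b := fun z => hB.2 z _ _
  have f2 : ∀ z, B z c a = B z a c := fun z => hB.2 z _ _
  have f3 : ∀ z, B z c b = B z b c := fun z => hB.2 z _ _
  have hαβ : ¬ (B a b c = 0 ∧ B b b c = 0) := by
    rintro ⟨h1, h2⟩
    obtain ⟨g₁, hg₁⟩ := hh (B a a) (hWle _ aaa aab aac)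
    obtain ⟨g₂, hg₂⟩ := hh (B a b) (hWle _ (by rw [f1, aab]) abb h1)
    obtain ⟨g₃, hg₃⟩ := hh (B b b) (hWle _ (by rw [f1, e1, abb]) bbb h2)
    exact hns.not_constant_tangent hB hab h hg₁ hg₂ hg₃
  have hαγ : ¬ (B a b c = 0 ∧ B b c c = 0) := by
    rintro ⟨h1, h2⟩
    obtain ⟨g₁, hg₁⟩ := hh (B a a) (hWle _ aaa aab aac)
    obtain ⟨g₂, hg₂⟩ := hh (B a c) (hWle _ (by rw [f2, aac]) (by rw [f3, h1]) acc)
    obtain ⟨g₃, hg₃⟩ := hh (B c c) (hWle _ (by rw [f2, e2, acc]) (by rw [f3, e3, h2]) ccc)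
    exact hns.not_constant_tangent hB hac h hg₁ hg₂ hg₃
  have key : ∀ u v : V4, u ∈ P ⊔ Q → v ∈ P ⊔ Q → VanishesOn B u v →
      LinearIndependent ℝ ![u, v] → (u ∉ P ∨ v ∉ P) → (u ∉ Q ∨ v ∉ Q) →
      ∃ R : PLine, LiesOn B R ∧ R ≤ P ⊔ Q ∧ R ≠ P ∧ R ≠ Q := by
    intro u v hu hv huv hli h1 h2
    have hus : u ∈ span ℝ {u, v} := subset_span (by simp)
    have hvs : v ∈ span ℝ {u, v} := subset_span (by simp)
    refine ⟨span ℝ {u, v}, huv.liesOn hB hli, span_le.2 ?_, ?_, ?_⟩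
    · rintro z (rfl | rfl) <;> assumption
    · intro he
      rw [he] at hus hvs
      tauto
    · intro he
      rw [he] at hus hvs
      tauto
  have haW := (le_sup_left : P ≤ P ⊔ Q) haP
  have hbW := (le_sup_left : P ≤ P ⊔ Q) hbP
  have hcW := (le_sup_right : Q ≤ P ⊔ Q) hcQ
  have hli : ∀ x y z : ℝ, x • a + y • b + z • c = 0 → x = 0 ∧ y = 0 ∧ z = 0 := by
    intro x y z h0
    have hz : z = 0 := by
      by_contra hz
      refine hcP ((P.smul_mem_iff hz).1 ?_)
      rw [← neg_eq_of_add_eq_zero_right h0]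
      exact P.neg_mem (P.add_mem (P.smul_mem _ haP) (P.smul_mem _ hbP))
    rw [hz, zero_smul, add_zero] at h0
    have := LinearIndependent.pair_iff.1 hab x y h0
    exact ⟨this.1, this.2, hz⟩
  have memP : ∀ x y z : ℝ, z ≠ 0 → x • a + y • b + z • c ∉ P := by
    intro x y z hz hmem
    have := (P.add_mem_iff_right (P.add_mem (P.smul_mem x haP) (P.smul_mem y hbP))).1 hmem
    exact hcP ((P.smul_mem_iff hz).1 this)
  have memQ : ∀ x y z : ℝ, y ≠ 0 → x • a + y • b + z • c ∉ Q := by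
    intro x y z hy hmem
    rw [add_right_comm] at hmem
    have := (Q.add_mem_iff_right (Q.add_mem (Q.smul_mem x haQ) (Q.smul_mem z hcQ))).1 hmem
    exact hbQ ((Q.smul_mem_iff hy).1 this)
  have memW : ∀ x y z : ℝ, x • a + y • b + z • c ∈ P ⊔ Q := fun x y z =>
    (P ⊔ Q).add_mem ((P ⊔ Q).add_mem ((P ⊔ Q).smul_mem _ haW) ((P ⊔ Q).smul_mem _ hbW))
      ((P ⊔ Q).smul_mem _ hcW)
  by_cases hα : B a b c = 0
  · have hβ : B b b c ≠ 0 := fun h => hαβ ⟨hα, h⟩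
    have hγ : B b c c ≠ 0 := fun h => hαγ ⟨hα, h⟩
    refine key ((1 : ℝ) • a + (0 : ℝ) • b + (0 : ℝ) • c)
      ((0 : ℝ) • a + B b c c • b + (- B b b c) • c) (memW _ _ _) (memW _ _ _) ?_ ?_
      (Or.inr (memP _ _ _ (neg_ne_zero.2 hβ))) (Or.inr (memQ _ _ _ hγ))
    · refine VanishesOn.of_forall hB fun s t => ?_
      simp only [map_add, map_smul, LinearMap.add_apply, LinearMap.smul_apply, smul_eq_mul,
        e1, e2, e3, f1, f2, f3, aaa, aab, abb, bbb, aac, acc, ccc, hα]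
      ring
    · rw [LinearIndependent.pair_iff]
      intro s t h0
      obtain ⟨h1, h2, -⟩ := hli s (t * B b c c) (t * - B b b c) (by rw [← h0]; module)
      exact ⟨h1, (mul_eq_zero.1 h2).resolve_right hγ⟩
  · have h2α : -2 * B a b c ≠ 0 := mul_ne_zero (by norm_num) hα
    refine key (B b b c • a + (-2 * B a b c) • b + (0 : ℝ) • c)
      (B b c c • a + (0 : ℝ) • b + (-2 * B a b c) • c) (memW _ _ _) (memW _ _ _) ?_ ?_
      (Or.inr (memP _ _ _ h2α)) (Or.inl (memQ _ _ _ h2α))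
    · refine VanishesOn.of_forall hB fun s t => ?_
      simp only [map_add, map_smul, LinearMap.add_apply, LinearMap.smul_apply, smul_eq_mul,
        e1, e2, e3, f1, f2, f3, aaa, aab, abb, bbb, aac, acc, ccc]
      ring
    · rw [LinearIndependent.pair_iff]
      intro s t h0
      obtain ⟨-, h1, h2⟩ := hli (s * B b b c + t * B b c c) (s * (-2 * B a b c))
        (t * (-2 * B a b c)) (by rw [← h0]; module)
      exact ⟨(mul_eq_zero.1 h1).resolve_right h2α, (mul_eq_zero.1 h2).resolve_right h2α⟩

/-- Three pairwise meeting lines of a nonsingular cubic surface are coplanar. -/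
theorem Nonsingular.le_sup_of_meets (hns : Nonsingular B) (hB : IsSymmTrilinear B)
    {P Q R : PLine} (hP : LiesOn B P) (hQ : LiesOn B Q) (hR : LiesOn B R) (hne : P ≠ Q)
    (hPQ : Meets P Q) (hPR : Meets P R) (hQR : Meets Q R) : R ≤ P ⊔ Q := by
  obtain ⟨x, hxP, hxR, hx0⟩ := meets_iff.1 hPR
  obtain ⟨y, hyQ, hyR, hy0⟩ := meets_iff.1 hQR
  by_cases hxy : LinearIndependent ℝ ![x, y]
  · rw [hR.1.eq_span_pair hxR hyR hxy, span_le]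
    rintro z (rfl | rfl)
    · exact (le_sup_left : P ≤ P ⊔ Q) hxP
    · exact (le_sup_right : Q ≤ P ⊔ Q) hyQ
  · rw [LinearIndependent.pair_iff' hx0] at hxy
    push Not at hxy
    obtain ⟨t, rfl⟩ := hxy
    have ht : t ≠ 0 := by
      rintro rfl
      simp at hy0
    have hxQ : x ∈ Q := (Q.smul_mem_iff ht).1 hyQ
    have hker : ∀ {S : PLine}, LiesOn B S → x ∈ S → S ≤ LinearMap.ker (B x x) :=
      fun hS hx z hz => (hS.vanishesOn hB hx hz).2.1
    have hφ : B x x ≠ 0 := fun h0 => hx0 (hns x 0 (fun v => by simp [h0]) (fun v => by simp)).1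
    have hk := LinearMap.finrank_range_add_finrank_ker (B x x)
    rw [LinearMap.range_eq_top.2 (LinearMap.surjective hφ)] at hk
    have : P ⊔ Q = LinearMap.ker (B x x) := by
      refine Submodule.eq_of_le_of_finrank_eq (sup_le (hker hP hxP) (hker hQ hxQ)) ?_
      rw [hP.1.finrank_sup hQ.1 hne hPQ]
      simp at hk
      omega
    rw [this]
    exact hker hR hxR

end Lines

section SixteenLines

variable {B : V4 →ₗ[ℝ] V4 →ₗ[ℝ] V4 →ₗ[ℝ] ℝ}

/-- If the residual line `M` in the plane of `P` and `T` meets another line `Q` meeting `T`,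
then `P` and `Q` meet. -/
theorem Nonsingular.meets_of_residual_meets (hns : Nonsingular B) (hB : IsSymmTrilinear B)
    {P T M Q : PLine} (hP : LiesOn B P) (hT : LiesOn B T) (hM : LiesOn B M) (hQ : LiesOn B Q)
    (hPT : P ≠ T) (hm : Meets P T) (hMle : M ≤ P ⊔ T) (hMT : M ≠ T) (hTQ : Meets T Q)
    (hMQ : Meets M Q) : Meets P Q := by
  have hTM := meets_of_le_sup hP.1 hT.1 hPT hm hT.1 hM.1 le_sup_right hMle
  have h := hns.le_sup_of_meets hB hT hM hQ hMT.symm hTM hTQ hMQ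
  exact meets_of_le_sup hP.1 hT.1 hPT hm hP.1 hQ.1 le_sup_left
    (h.trans (sup_le le_sup_right hMle))

/-- Five skew real lines, all meeting a real line and four of them meeting a second one,
force sixteen real lines. -/
theorem Nonsingular.sixteen_lines (hns : Nonsingular B) (hB : IsSymmTrilinear B)
    {L : Fin 5 → PLine} {T₁ T₂ : PLine} (hL : ∀ i, LiesOn B (L i))
    (hskew : ∀ i j, Meets (L i) (L j) → i = j) (h₁ : LiesOn B T₁) (h₂ : LiesOn B T₂)
    (h₁₂ : ¬ Meets T₁ T₂) (hm₁ : ∀ i, Meets T₁ (L i))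
    (hm₂ : ∀ i : Fin 4, Meets T₂ (L i.castSucc)) : {P | LiesOn B P}.ncard ≠ 15 := by
  have hLT₁ : ∀ i, L i ≠ T₁ := by
    intro i hi
    have h0 := hskew i 0 (hi ▸ hm₁ 0)
    have h1 := hskew i 1 (hi ▸ hm₁ 1)
    rw [h0] at h1
    exact absurd h1 (by decide)
  have hLT₂ : ∀ i, L i ≠ T₂ := by
    intro i hi
    have h0 := hskew i 0 (hi ▸ hm₂ 0)
    have h1 := hskew i 1 (hi ▸ hm₂ 1)
    rw [h0] at h1
    exact absurd h1 (by decide)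
  choose M hM hMle hML hMT using fun i =>
    hns.exists_third_line hB (hL i) h₁ (hLT₁ i) (hm₁ i).symm
  choose N hN hNle hNL hNT using fun i : Fin 4 =>
    hns.exists_third_line hB (hL i.castSucc) h₂ (hLT₂ _) (hm₂ i).symm
  have hML' : ∀ i, Meets (M i) (L i) := fun i => meets_of_le_sup (hL i).1 h₁.1 (hLT₁ i)
    (hm₁ i).symm (hM i).1 (hL i).1 (hMle i) le_sup_left
  have hMT' : ∀ i, Meets (M i) T₁ := fun i => meets_of_le_sup (hL i).1 h₁.1 (hLT₁ i)
    (hm₁ i).symm (hM i).1 h₁.1 (hMle i) le_sup_right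
  have hNL' : ∀ i, Meets (N i) (L i.castSucc) := fun i => meets_of_le_sup (hL _).1 h₂.1 (hLT₂ _)
    (hm₂ i).symm (hN i).1 (hL _).1 (hNle i) le_sup_left
  have hNT' : ∀ i, Meets (N i) T₂ := fun i => meets_of_le_sup (hL _).1 h₂.1 (hLT₂ _)
    (hm₂ i).symm (hN i).1 h₂.1 (hNle i) le_sup_right
  have hMmeets : ∀ i k, Meets (M i) (L k) → i = k := fun i k h =>
    hskew i k (hns.meets_of_residual_meets hB (hL i) h₁ (hM i) (hL k) (hLT₁ i) (hm₁ i).symm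
      (hMle i) (hMT i) (hm₁ k) h)
  have hNmeets : ∀ i k : Fin 4, Meets (N i) (L k.castSucc) → i = k := fun i k h =>
    Fin.castSucc_injective _ (hskew _ _ (hns.meets_of_residual_meets hB (hL _) h₂ (hN i) (hL _)
      (hLT₂ _) (hm₂ i).symm (hNle i) (hNT i) (hm₂ k) h))
  have hLinj : ∀ i k, L i = L k → i = k := fun i k h => hskew i k (h ▸ (hL i).1.meets_self)
  have hMN : ∀ i k, M i ≠ N k := by
    intro i k h
    have hi : i = k.castSucc := hMmeets i _ (h ▸ hNL' k)
    subst hi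
    have hle := hns.le_sup_of_meets hB (hL _) (hM _) h₂ (hML _).symm (hML' _).symm
      (hm₂ k).symm (h ▸ hNT' k)
    exact h₁₂ (meets_of_le_sup (hL _).1 h₁.1 (hLT₁ _) (hm₁ _).symm h₁.1 h₂.1 le_sup_right
      (hle.trans (sup_le le_sup_left (hMle _))))
  have hML₀ : ∀ i k, M i ≠ L k := fun i k h => by
    have : i = k := (hskew _ _ (h ▸ hML' i)).symm
    exact hML i (this ▸ h)
  have hNL₀ : ∀ i k, N i ≠ L k := fun i k h => by
    have : i.castSucc = k := (hskew _ _ (h ▸ hNL' i)).symm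
    exact hNL i (this ▸ h)
  have hT : T₁ ≠ T₂ := fun h => h₁₂ (h ▸ h₁.1.meets_self)
  have hMT₂ : ∀ i, M i ≠ T₂ := fun i h => h₁₂ (h ▸ hMT' i).symm
  have hNT₁ : ∀ i, N i ≠ T₁ := fun i h => h₁₂ (h ▸ hNT' i)
  have hMinj : ∀ i k, M i = M k → i = k := fun i k h => hMmeets i k (h ▸ hML' k)
  have hNinj : ∀ i k, N i = N k → i = k := fun i k h => hNmeets i k (h ▸ hNL' k)
  let f : (Fin 5 ⊕ Bool) ⊕ (Fin 5 ⊕ Fin 4) → PLine :=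
    Sum.elim (Sum.elim L fun b => cond b T₁ T₂) (Sum.elim M N)
  have hf : Function.Injective f := by
    refine Function.Injective.sumElim (Function.Injective.sumElim hLinj ?_ ?_)
      (Function.Injective.sumElim hMinj hNinj hMN) ?_
    · rintro (_ | _) (_ | _) <;> simp [hT, hT.symm]
    · rintro i (_ | _) <;> simp [hLT₁, hLT₂]
    · rintro (i | _ | _) (k | k) <;>
        simp [(hML₀ _ _).symm, (hNL₀ _ _).symm, (hMT₂ _).symm, (hMT _).symm, (hNT₁ _).symm,
          (hNT _).symm]
  have hfs : Set.range f ⊆ {P | LiesOn B P} := by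
    rintro _ ⟨((i | _ | _) | (i | i)), rfl⟩
    exacts [hL i, h₂, h₁, hM i, hN i]
  intro h15
  have hle := Set.ncard_le_ncard hfs (Set.finite_of_ncard_ne_zero (by omega))
  rw [h15, ← Set.image_univ, Set.ncard_image_of_injective _ hf, Set.ncard_univ,
    Nat.card_eq_fintype_card] at hle
  simp at hle

end SixteenLines

section Frames

variable {U : Type*} [AddCommGroup U] [Module ℝ U]

/-- `a` and `b` identify `V4` with `U × U` (when `U` is a plane). -/
def IsFrame (a b : U →ₗ[ℝ] V4) : Prop := ∀ u v, a u + b v = 0 → u = 0 ∧ v = 0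

/-- The line which is the graph of `X` in the frame `a`, `b`. -/
def graphLine (a b : U →ₗ[ℝ] V4) (X : U →ₗ[ℝ] U) : PLine := LinearMap.range (a + b ∘ₗ X)

theorem IsFrame.eq_zero_of_skew {a b : U →ₗ[ℝ] V4} (h : IsFrame a b) {X Y : U →ₗ[ℝ] U}
    (hXY : graphLine a b X ⊓ graphLine a b Y = ⊥) {u : U} (hu : (X - Y) u = 0) : u = 0 := by
  have h0 : X u = Y u := sub_eq_zero.1 hu
  have hmem : a u + b (X u) ∈ graphLine a b X ⊓ graphLine a b Y :=
    ⟨⟨u, rfl⟩, ⟨u, by simp [h0]⟩⟩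
  rw [hXY, Submodule.mem_bot] at hmem
  exact (h _ _ hmem).1

theorem IsFrame.exists_eq {a b : U →ₗ[ℝ] V4} (h : IsFrame a b) (hU : Module.finrank ℝ U = 2)
    (v : V4) : ∃ x y, v = a x + b y := by
  have : FiniteDimensional ℝ U := Module.finite_of_finrank_pos (by omega)
  have hinj : Function.Injective (a.coprod b) := by
    rw [injective_iff_map_eq_zero]
    rintro ⟨x, y⟩ hxy
    simpa using h x y hxy
  obtain ⟨⟨x, y⟩, hxy⟩ := (LinearMap.injective_iff_surjective_of_finrank_eq_finrank
    (by simp [hU])).1 hinj v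
  exact ⟨x, y, hxy.symm⟩

theorem Skew.isCompl {P Q : PLine} (h : Skew P Q) : IsCompl P Q := by
  refine ⟨disjoint_iff.2 h.2.2, codisjoint_iff.2 (Submodule.eq_top_of_finrank_eq ?_)⟩
  have h1 := Submodule.finrank_sup_add_finrank_inf_eq P Q
  rw [h.1, h.2.1, h.2.2, finrank_bot] at h1
  simpa using h1

/-- A line skew to `Q` is a graph over any other line skew to `Q`. -/
theorem exists_graph {P Q M : PLine} (hPQ : Skew P Q) (hMQ : Skew M Q) :
    ∃ g : P →ₗ[ℝ] V4, (∀ u, g u ∈ Q) ∧ M = LinearMap.range (P.subtype + g) := by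
  have hc := hMQ.isCompl
  have hex : ∃ g : P →ₗ[ℝ] V4, (∀ u, g u ∈ Q) ∧ ∀ u : P, (u : V4) + g u ∈ M := by
    refine ⟨-(Q.projection M hc.symm ∘ₗ P.subtype), fun u => ?_, fun u => ?_⟩
    · exact Q.neg_mem (Q.projection_apply_mem hc.symm u)
    · simpa [sub_eq_add_neg] using Submodule.sub_projection_mem hc.symm (u : V4)
  obtain ⟨g, hg, hgM⟩ := hex
  refine ⟨g, hg, (Submodule.eq_of_le_of_finrank_eq ?_ ?_).symm⟩
  · rintro _ ⟨u, rfl⟩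
    exact hgM u
  · rw [LinearMap.finrank_range_of_inj, hMQ.1, hPQ.1]
    rw [injective_iff_map_eq_zero]
    intro u hu
    have h1 : (u : V4) + g u = 0 := hu
    have h2 : (u : V4) ∈ P ⊓ Q := ⟨u.2, by
      rw [eq_neg_of_add_eq_zero_left h1]
      exact Q.neg_mem (hg u)⟩
    rw [hPQ.2.2, Submodule.mem_bot] at h2
    exact Subtype.ext h2

/-- The five lines are `a`, `b` and the graphs of `1`, `A`, `C` in the frame `a`, `b`. -/
structure FramedLines (a b : U →ₗ[ℝ] V4) (A C : U →ₗ[ℝ] U) (L : Fin 5 → PLine) : Prop where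
  isFrame : IsFrame a b
  eq₀ : L 0 = graphLine a b 0
  eq₁ : L 1 = LinearMap.range b
  eq₂ : L 2 = graphLine a b 1
  eq₃ : L 3 = graphLine a b A
  eq₄ : L 4 = graphLine a b C

theorem exists_framedLines {L : Fin 5 → PLine} (hL : PairwiseSkew L) :
    ∃ (a b : L 0 →ₗ[ℝ] V4) (A C : L 0 →ₗ[ℝ] L 0), FramedLines a b A C L := by
  have h01 := hL 0 1 (by decide)
  obtain ⟨b, hb, hb2⟩ := exists_graph h01 (hL 2 1 (by decide))
  have hinj : ∀ v, b v = 0 → v = 0 := by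
    intro v hv
    have h1 : (v : V4) ∈ L 0 ⊓ L 2 := ⟨v.2, by
      rw [hb2]
      exact ⟨v, by simp [hv]⟩⟩
    rw [(hL 0 2 (by decide)).2.2, Submodule.mem_bot] at h1
    exact Subtype.ext h1
  have hker := LinearMap.ker_eq_bot'.2 hinj
  have hb1 : LinearMap.range b = L 1 := by
    refine Submodule.eq_of_le_of_finrank_eq ?_ ?_
    · rintro _ ⟨u, rfl⟩
      exact hb u
    · rw [LinearMap.finrank_range_of_inj (LinearMap.ker_eq_bot.1 hker), h01.1, h01.2.1]
  have hfr : IsFrame (L 0).subtype b := by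
    intro u v huv
    have h1 : (u : V4) ∈ L 0 ⊓ L 1 := ⟨u.2, by
      rw [eq_neg_of_add_eq_zero_left (show (u : V4) + b v = 0 from huv)]
      exact (L 1).neg_mem (hb v)⟩
    rw [h01.2.2, Submodule.mem_bot] at h1
    have h2 : u = 0 := Subtype.ext h1
    exact ⟨h2, hinj v (by simpa [h2] using huv)⟩
  obtain ⟨c, hc⟩ := LinearMap.exists_leftInverse_of_injective b hker
  have hgraph : ∀ M : PLine, Skew M (L 1) →
      ∃ X : L 0 →ₗ[ℝ] L 0, M = graphLine (L 0).subtype b X := by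
    intro M hM
    obtain ⟨g, hg, hgM⟩ := exists_graph h01 hM
    refine ⟨c ∘ₗ g, ?_⟩
    have : b ∘ₗ (c ∘ₗ g) = g := by
      ext1 u
      obtain ⟨x, hx⟩ : g u ∈ LinearMap.range b := hb1 ▸ hg u
      have hcx : c (b x) = x := LinearMap.congr_fun hc x
      simp [← hx, hcx]
    rw [graphLine, this, hgM]
  obtain ⟨A, hA⟩ := hgraph _ (hL 3 1 (by decide))
  obtain ⟨C, hC⟩ := hgraph _ (hL 4 1 (by decide))
  refine ⟨(L 0).subtype, b, A, C, hfr, ?_, hb1.symm, ?_, hA, hC⟩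
  · simp [graphLine]
  · rw [hb2]
    rfl

end Frames

section PlaneEndomorphisms

variable {U : Type*} [AddCommGroup U] [Module ℝ U]

theorem span_pair_eq_top (hU : Module.finrank ℝ U = 2) {e₁ e₂ : U}
    (he : LinearIndependent ℝ ![e₁, e₂]) : span ℝ {e₁, e₂} = ⊤ := by
  have : FiniteDimensional ℝ U := Module.finite_of_finrank_pos (by omega)
  have h := he.span_eq_top_of_card_eq_finrank' (by simp [hU])
  rwa [Matrix.range_cons, Matrix.range_cons, Matrix.range_empty, Set.union_empty,
    Set.singleton_union] at h

theorem exists_eq_combination (hU : Module.finrank ℝ U = 2) {e₁ e₂ : U}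
    (he : LinearIndependent ℝ ![e₁, e₂]) (x : U) : ∃ s t : ℝ, x = s • e₁ + t • e₂ := by
  obtain ⟨s, t, h⟩ := mem_span_pair.1 (span_pair_eq_top hU he ▸ mem_top : x ∈ span ℝ {e₁, e₂})
  exact ⟨s, t, h.symm⟩

theorem range_eq_span_pair (hU : Module.finrank ℝ U = 2) {e₁ e₂ : U}
    (he : LinearIndependent ℝ ![e₁, e₂]) (f : U →ₗ[ℝ] V4) :
    LinearMap.range f = span ℝ {f e₁, f e₂} := by
  rw [LinearMap.range_eq_map, ← span_pair_eq_top hU he, map_span, Set.image_pair]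

/-- An endomorphism of a real plane has, in a suitable basis, a diagonal matrix with distinct
entries, a triangular matrix with equal diagonal entries, or the matrix of a complex scalar. -/
theorem plane_endomorphism_trichotomy (hU : Module.finrank ℝ U = 2) (A : U →ₗ[ℝ] U) :
    ∃ e₁ e₂ : U, LinearIndependent ℝ ![e₁, e₂] ∧
      ((∃ l m : ℝ, l ≠ m ∧ A e₁ = l • e₁ ∧ A e₂ = m • e₂) ∨
        (∃ l c : ℝ, A e₁ = l • e₁ ∧ A e₂ = c • e₁ + l • e₂) ∨
        ∃ p ω : ℝ, ω ≠ 0 ∧ A e₁ = p • e₁ + ω • e₂ ∧ A e₂ = (-ω) • e₁ + p • e₂) := by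
  by_cases h : ∃ (e₁ : U) (l : ℝ), e₁ ≠ 0 ∧ A e₁ = l • e₁
  · obtain ⟨e₁, l, he₁, hA₁⟩ := h
    obtain ⟨e₂, he⟩ := exists_linearIndependent_pair_of_one_lt_finrank (R := ℝ)
      (by rw [hU]; norm_num) he₁
    obtain ⟨c, m, hA₂⟩ := exists_eq_combination hU he (A e₂)
    by_cases hlm : l = m
    · exact ⟨e₁, e₂, he, Or.inr (Or.inl ⟨l, c, hA₁, by rw [hA₂, hlm]⟩)⟩
    · have hml : m - l ≠ 0 := sub_ne_zero.2 (Ne.symm hlm)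
      refine ⟨e₁, e₂ + (c / (m - l)) • e₁, ?_, Or.inl ⟨l, m, hlm, hA₁, ?_⟩⟩
      · rw [LinearIndependent.pair_iff] at he ⊢
        intro s t hst
        obtain ⟨h1, h2⟩ := he (s + t * (c / (m - l))) t (by rw [← hst]; module)
        simp_all
      · have hc : c + (c / (m - l)) * l = m * (c / (m - l)) := by
          field_simp
          ring
        rw [map_add, map_smul, hA₁, hA₂]
        linear_combination (norm := module) hc • e₁
  · push Not at h
    have : Nontrivial U := Module.nontrivial_of_finrank_pos (R := ℝ) (by omega)
    obtain ⟨e₁, he₁⟩ := exists_ne (0 : U)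
    have he : LinearIndependent ℝ ![e₁, A e₁] :=
      (LinearIndependent.pair_iff' he₁).2 fun a ha => h e₁ a he₁ ha.symm
    obtain ⟨x, y, hxy⟩ := exists_eq_combination hU he (A (A e₁))
    have hD : y ^ 2 / 4 + x < 0 := by
      by_contra! hD
      have hs := Real.sq_sqrt hD
      set r := √(y ^ 2 / 4 + x)
      refine h (A e₁ + (r - y / 2) • e₁) (r + y / 2) ?_ ?_
      · intro h0
        have := LinearIndependent.pair_iff.1 he (r - y / 2) 1 (by rw [← h0]; module)
        exact one_ne_zero this.2
      · rw [map_add, map_smul, hxy]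
        have hx : x = (r + y / 2) * (r - y / 2) := by linear_combination -hs
        rw [hx]
        module
    have hs := Real.sq_sqrt (neg_nonneg.2 hD.le)
    have hω : √(-(y ^ 2 / 4 + x)) ≠ 0 := (Real.sqrt_pos.2 (neg_pos.2 hD)).ne'
    set ω := √(-(y ^ 2 / 4 + x))
    refine ⟨e₁, ω⁻¹ • (A e₁ - (y / 2) • e₁), ?_, Or.inr (Or.inr ⟨y / 2, ω, hω, ?_, ?_⟩)⟩
    · rw [LinearIndependent.pair_iff] at he ⊢
      intro s t hst
      obtain ⟨h1, h2⟩ := he (s - t * ω⁻¹ * (y / 2)) (t * ω⁻¹) (by rw [← hst]; module)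
      have ht : t = 0 := (mul_eq_zero.1 h2).resolve_right (inv_ne_zero hω)
      simpa [ht] using h1
    · rw [smul_smul, mul_inv_cancel₀ hω]
      module
    · have hx : x = -ω ^ 2 - y ^ 2 / 4 := by linear_combination hs
      rw [map_smul, map_sub, map_smul, hxy, hx]
      have h1 : -ω = ω⁻¹ * (-ω ^ 2) := by field_simp
      rw [h1]
      module

theorem det_ne_zero_of_injective {e₁ e₂ : U} (he : LinearIndependent ℝ ![e₁, e₂])
    {X : U →ₗ[ℝ] U} (hX : ∀ u, X u = 0 → u = 0) {p q r s : ℝ} (h₁ : X e₁ = p • e₁ + r • e₂)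
    (h₂ : X e₂ = q • e₁ + s • e₂) : p * s - q * r ≠ 0 := by
  intro h0
  rw [LinearIndependent.pair_iff] at he
  have h1 := he s (-r) (hX _ (by
    rw [map_add, map_smul, map_smul, h₁, h₂]
    linear_combination (norm := module) h0 • e₁))
  have h2 := he q (-p) (hX _ (by
    rw [map_add, map_smul, map_smul, h₁, h₂]
    linear_combination (norm := module) (-h0) • e₂))
  have h3 := he 1 0 (hX _ (by
    rw [map_add, map_smul, map_smul, h₁]
    simp [neg_eq_zero.1 h1.2, neg_eq_zero.1 h2.2]))
  exact one_ne_zero h3.1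

end PlaneEndomorphisms

section NormalForm

variable {B : V4 →ₗ[ℝ] V4 →ₗ[ℝ] V4 →ₗ[ℝ] ℝ}

theorem Nonsingular.exists_ne_zero (hns : Nonsingular B) (hB : IsSymmTrilinear B) :
    ∃ v, B v v v ≠ 0 := by
  by_contra! h
  obtain ⟨u, hu⟩ := exists_ne (0 : V4)
  refine hu (hns u 0 (fun v => ?_) (fun v => by simp)).1
  rw [(VanishesOn.of_forall hB fun s t => h (s • u + t • v)).2.1]
  simp

/-- Four lines of a nonsingular cubic surface with a tangential transversal do not exist. -/
theorem Nonsingular.no_double_transversal (hns : Nonsingular B) (hB : IsSymmTrilinear B)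
    {a₁ a₂ b₁ b₂ : V4} (hab : LinearIndependent ℝ ![a₁, b₁])
    (hspan : ∀ v, ∃ x y z w : ℝ, v = x • a₁ + y • a₂ + (z • b₁ + w • b₂))
    {l c : ℝ} (hl0 : l ≠ 0) (hl1 : l ≠ 1) (h0 : VanishesOn B a₁ a₂) (h1 : VanishesOn B b₁ b₂)
    (h2 : VanishesOn B (a₁ + b₁) (a₂ + b₂))
    (h3 : VanishesOn B (a₁ + l • b₁) (a₂ + (c • b₁ + l • b₂))) : False := by
  have hT : VanishesOn B a₁ b₁ := VanishesOn.of_four_points hB hl0 hl1 h0.1 h1.1 h2.1 h3.1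
  obtain ⟨taaa, taab, tabb, tbbb⟩ := hT
  have aaa := h0.2.1
  have bbb := h1.2.1
  have e1 : ∀ z, B b₁ a₁ z = B a₁ b₁ z := fun z => hB.1 _ _ z
  have f1 : ∀ z, B z b₁ a₁ = B z a₁ b₁ := fun z => hB.2 z _ _
  have k2 := h2.2.1
  have k3 := h3.2.1
  simp only [map_add, map_smul, LinearMap.add_apply, LinearMap.smul_apply, smul_eq_mul, e1,
    taab, tabb, tbbb, aaa, bbb] at k2 k3
  have hX : B a₁ a₁ b₂ = -2 * B a₁ b₁ a₂ := by
    have : l * (1 - l) * (B a₁ a₁ b₂ + 2 * B a₁ b₁ a₂) = 0 := by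
      linear_combination k3 - l ^ 2 * k2
    have h := (mul_eq_zero.1 this).resolve_left
      (mul_ne_zero hl0 (sub_ne_zero.2 hl1.symm))
    linear_combination h
  have hY : B b₁ b₁ a₂ = -2 * B a₁ b₁ b₂ := by linear_combination k2 - hX
  have hsing : ∀ s t : ℝ, s * (2 * B a₁ b₁ a₂) + t * B b₁ b₁ a₂ = 0 → s = 0 ∧ t = 0 := by
    intro s t hst
    refine LinearIndependent.pair_iff.1 hab s t
      (hns (s • a₁ + t • b₁) 0 (fun v => ?_) (fun v => by simp)).1
    obtain ⟨x, y, z, w, rfl⟩ := hspan v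
    simp only [map_add, map_smul, LinearMap.add_apply, LinearMap.smul_apply, smul_eq_mul, e1, f1,
      taaa, taab, tabb, tbbb, aaa, bbb, map_zero, LinearMap.zero_apply, hX]
    rw [hY] at hst ⊢
    linear_combination (y * t - w * s) * hst
  have h4 := hsing (B b₁ b₁ a₂) (-(2 * B a₁ b₁ a₂)) (by ring)
  have h5 := hsing 1 0 (by linear_combination -h4.2)
  exact one_ne_zero h5.1

variable {U : Type*} [AddCommGroup U] [Module ℝ U] {a b : U →ₗ[ℝ] V4} {A C : U →ₗ[ℝ] U}
  {L : Fin 5 → PLine}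

theorem IsFrame.eq_zero (h : IsFrame a b) {e₁ e₂ : U} (he : LinearIndependent ℝ ![e₁, e₂])
    {x y z w : ℝ} (h0 : x • a e₁ + y • a e₂ + (z • b e₁ + w • b e₂) = 0) :
    x = 0 ∧ y = 0 ∧ z = 0 ∧ w = 0 := by
  have := h (x • e₁ + y • e₂) (z • e₁ + w • e₂) (by simpa using h0)
  rw [LinearIndependent.pair_iff] at he
  exact ⟨(he _ _ this.1).1, (he _ _ this.1).2, (he _ _ this.2).1, (he _ _ this.2).2⟩

theorem IsFrame.exists_combination (h : IsFrame a b) (hU : Module.finrank ℝ U = 2) {e₁ e₂ : U}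
    (he : LinearIndependent ℝ ![e₁, e₂]) (v : V4) :
    ∃ x y z w : ℝ, v = x • a e₁ + y • a e₂ + (z • b e₁ + w • b e₂) := by
  obtain ⟨u, u', rfl⟩ := h.exists_eq hU v
  obtain ⟨x, y, rfl⟩ := exists_eq_combination hU he u
  obtain ⟨z, w, rfl⟩ := exists_eq_combination hU he u'
  exact ⟨x, y, z, w, by simp⟩

theorem IsFrame.linearIndependent_left (h : IsFrame a b) {e₁ e₂ : U}
    (he : LinearIndependent ℝ ![e₁, e₂]) : LinearIndependent ℝ ![a e₁, b e₁] := by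
  rw [LinearIndependent.pair_iff]
  intro s t hst
  obtain ⟨h1, -, h2, -⟩ := h.eq_zero he (x := s) (y := 0) (z := t) (w := 0) (by simpa using hst)
  exact ⟨h1, h2⟩

theorem IsFrame.linearIndependent_right (h : IsFrame a b) {e₁ e₂ : U}
    (he : LinearIndependent ℝ ![e₁, e₂]) : LinearIndependent ℝ ![a e₂, b e₂] := by
  rw [LinearIndependent.pair_iff]
  intro s t hst
  obtain ⟨-, h1, -, h2⟩ := h.eq_zero he (x := 0) (y := s) (z := 0) (w := t) (by simpa using hst)
  exact ⟨h1, h2⟩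

theorem IsFrame.meets_graphLine (h : IsFrame a b) {X : U →ₗ[ℝ] U} {u : U} {k : ℝ} (hu : u ≠ 0)
    (hX : X u = k • u) : Meets (span ℝ {a u, b u}) (graphLine a b X) := by
  refine meets_iff.2 ⟨a u + k • b u, mem_span_pair.2 ⟨1, k, by simp⟩, ⟨u, by simp [hX]⟩, ?_⟩
  intro h0
  exact hu (h u (k • u) (by simpa using h0)).1

theorem IsFrame.meets_range (h : IsFrame a b) {u : U} (hu : u ≠ 0) :
    Meets (span ℝ {a u, b u}) (LinearMap.range b) := by
  refine meets_iff.2 ⟨b u, subset_span (by simp), ⟨u, rfl⟩, fun h0 => hu ?_⟩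
  exact (h 0 u (by simpa using h0)).2

theorem FramedLines.meets (hf : FramedLines a b A C L) {u : U} {k : ℝ} (hu : u ≠ 0)
    (hA : A u = k • u) (i : Fin 4) : Meets (span ℝ {a u, b u}) (L i.castSucc) := by
  fin_cases i
  · exact hf.eq₀ ▸ hf.isFrame.meets_graphLine (k := 0) hu (by simp)
  · exact hf.eq₁ ▸ hf.isFrame.meets_range hu
  · exact hf.eq₂ ▸ hf.isFrame.meets_graphLine (k := 1) hu (by simp)
  · exact hf.eq₃ ▸ hf.isFrame.meets_graphLine hu hA

theorem LiesOn.vanishesOn_graph (hB : IsSymmTrilinear B) {X : U →ₗ[ℝ] U}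
    (h : LiesOn B (graphLine a b X)) (u v : U) :
    VanishesOn B (a u + b (X u)) (a v + b (X v)) :=
  h.vanishesOn hB ⟨u, rfl⟩ ⟨v, rfl⟩

theorem PairwiseSkew.eq_of_meets {n : ℕ} {L : Fin n → PLine} (hL : PairwiseSkew L) {i j : Fin n}
    (h : Meets (L i) (L j)) : i = j :=
  by_contra fun hij => h (hL i j hij).2.2

theorem Nonsingular.no_transversal_pair (hns : Nonsingular B) (hB : IsSymmTrilinear B)
    (h15 : {P | LiesOn B P}.ncard = 15) (hL : PairwiseSkew L) (hLB : ∀ i, LiesOn B (L i))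
    (hf : FramedLines a b A C L) {e₁ e₂ : U} (he : LinearIndependent ℝ ![e₁, e₂])
    {l m p : ℝ} (hl0 : l ≠ 0) (hl1 : l ≠ 1) (hm0 : m ≠ 0) (hm1 : m ≠ 1)
    (hA₁ : A e₁ = l • e₁) (hA₂ : A e₂ = m • e₂) (hC : C e₁ = p • e₁) : False := by
  have he₁ : e₁ ≠ 0 := he.ne_zero 0
  have he₂ : e₂ ≠ 0 := he.ne_zero 1
  have hV : ∀ {u : U} {k : ℝ}, k ≠ 0 → k ≠ 1 → A u = k • u → VanishesOn B (a u) (b u) := by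
    intro u k hk0 hk1 hk
    have h0 := ((hf.eq₀ ▸ hLB 0).vanishesOn_graph hB u u).1
    have h1 := ((hf.eq₁ ▸ hLB 1).vanishesOn hB ⟨u, rfl⟩ ⟨u, rfl⟩).1
    have h2 := ((hf.eq₂ ▸ hLB 2).vanishesOn_graph hB u u).1
    have h3 := ((hf.eq₃ ▸ hLB 3).vanishesOn_graph hB u u).1
    simp only [LinearMap.zero_apply, map_zero, add_zero] at h0
    simp only [hk, map_smul] at h3
    exact VanishesOn.of_four_points hB hk0 hk1 h0 h1 h2 h3
  refine hns.sixteen_lines hB hLB (fun i j => hL.eq_of_meets)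
    ((hV hl0 hl1 hA₁).liesOn hB (hf.isFrame.linearIndependent_left he))
    ((hV hm0 hm1 hA₂).liesOn hB (hf.isFrame.linearIndependent_right he)) ?_ ?_
    (hf.meets he₂ hA₂) h15
  · rw [meets_iff]
    rintro ⟨x, h1, h2, hx⟩
    obtain ⟨s, t, rfl⟩ := mem_span_pair.1 h1
    obtain ⟨s', t', h3⟩ := mem_span_pair.1 h2
    obtain ⟨hs, -, ht, -⟩ := hf.isFrame.eq_zero he (x := s) (y := -s') (z := t) (w := -t') (by
      linear_combination (norm := module) -h3)
    simp [hs, ht] at hx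
  · refine Fin.lastCases ?_ (hf.meets he₁ hA₁)
    rw [show Fin.last 4 = 4 from rfl, hf.eq₄]
    exact hf.isFrame.meets_graphLine he₁ hC

end NormalForm

section NormalForm

variable {B : V4 →ₗ[ℝ] V4 →ₗ[ℝ] V4 →ₗ[ℝ] ℝ}
  {U : Type*} [AddCommGroup U] [Module ℝ U] {a b : U →ₗ[ℝ] V4} {A C : U →ₗ[ℝ] U}
  {L : Fin 5 → PLine}

/-- The vanishing conditions imposed by the five lines, in a basis of the plane `U`. -/
theorem FramedLines.vanishesOn (hf : FramedLines a b A C L) (hB : IsSymmTrilinear B)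
    (hLB : ∀ i, LiesOn B (L i)) (u v : U) :
    VanishesOn B (a u) (a v) ∧ VanishesOn B (b u) (b v) ∧
      VanishesOn B (a u + b u) (a v + b v) ∧
      VanishesOn B (a u + b (A u)) (a v + b (A v)) ∧
      VanishesOn B (a u + b (C u)) (a v + b (C v)) := by
  refine ⟨?_, ?_, ?_, ?_, ?_⟩
  · have h := (hf.eq₀ ▸ hLB 0).vanishesOn_graph hB u v
    simpa only [LinearMap.zero_apply, map_zero, add_zero] using h
  · exact (hf.eq₁ ▸ hLB 1).vanishesOn hB ⟨u, rfl⟩ ⟨v, rfl⟩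
  · exact (hf.eq₂ ▸ hLB 2).vanishesOn_graph hB u v
  · exact (hf.eq₃ ▸ hLB 3).vanishesOn_graph hB u v
  · exact (hf.eq₄ ▸ hLB 4).vanishesOn_graph hB u v

/-- Pairwise skewness of the graph lines, as injectivity of differences. -/
theorem FramedLines.injective (hf : FramedLines a b A C L) (hL : PairwiseSkew L) :
    (∀ u, (A - 0) u = 0 → u = 0) ∧ (∀ u, (A - 1) u = 0 → u = 0) ∧
      (∀ u, (C - 0) u = 0 → u = 0) ∧ (∀ u, (C - 1) u = 0 → u = 0) ∧
      ∀ u, (C - A) u = 0 → u = 0 := by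
  have h30 := (hL 3 0 (by decide)).2.2
  have h32 := (hL 3 2 (by decide)).2.2
  have h40 := (hL 4 0 (by decide)).2.2
  have h42 := (hL 4 2 (by decide)).2.2
  have h43 := (hL 4 3 (by decide)).2.2
  rw [hf.eq₃, hf.eq₀] at h30
  rw [hf.eq₃, hf.eq₂] at h32
  rw [hf.eq₄, hf.eq₀] at h40
  rw [hf.eq₄, hf.eq₂] at h42
  rw [hf.eq₄, hf.eq₃] at h43
  exact ⟨fun u => hf.isFrame.eq_zero_of_skew h30, fun u => hf.isFrame.eq_zero_of_skew h32,
    fun u => hf.isFrame.eq_zero_of_skew h40, fun u => hf.isFrame.eq_zero_of_skew h42,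
    fun u => hf.isFrame.eq_zero_of_skew h43⟩

theorem FramedLines.eigenvalue_ne (hf : FramedLines a b A C L) (hL : PairwiseSkew L) {u : U}
    {k : ℝ} (hu : u ≠ 0) (hA : A u = k • u) : k ≠ 0 ∧ k ≠ 1 := by
  obtain ⟨h0, h1, -⟩ := hf.injective hL
  constructor
  · rintro rfl
    exact hu (h0 u (by simp [hA]))
  · rintro rfl
    exact hu (h1 u (by simp [hA]))

theorem Nonsingular.no_distinct_eigenvalues (hns : Nonsingular B) (hB : IsSymmTrilinear B)
    (h15 : {P | LiesOn B P}.ncard = 15) (hU : Module.finrank ℝ U = 2) (hL : PairwiseSkew L)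
    (hLB : ∀ i, LiesOn B (L i)) (hf : FramedLines a b A C L) {e₁ e₂ : U}
    (he : LinearIndependent ℝ ![e₁, e₂]) {l m : ℝ} (hlm : l ≠ m)
    (hA₁ : A e₁ = l • e₁) (hA₂ : A e₂ = m • e₂) : False := by
  obtain ⟨hl0, hl1⟩ := hf.eigenvalue_ne hL (he.ne_zero 0) hA₁
  obtain ⟨hm0, hm1⟩ := hf.eigenvalue_ne hL (he.ne_zero 1) hA₂
  obtain ⟨p, r, hC₁⟩ := exists_eq_combination hU he (C e₁)
  obtain ⟨q, s, hC₂⟩ := exists_eq_combination hU he (C e₂)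
  by_cases hr : r = 0
  · exact hns.no_transversal_pair hB h15 hL hLB hf he hl0 hl1 hm0 hm1 hA₁ hA₂
      (by simpa [hr] using hC₁)
  by_cases hq : q = 0
  · exact hns.no_transversal_pair hB h15 hL hLB hf (LinearIndependent.pair_symm_iff.1 he)
      hm0 hm1 hl0 hl1 hA₂ hA₁ (by simpa [hq] using hC₂)
  obtain ⟨-, -, h0, h1, h3⟩ := hf.injective hL
  have d0 := det_ne_zero_of_injective he h0 (p := p) (r := r) (q := q) (s := s)
    (by simp [hC₁]) (by simp [hC₂])
  have d1 := det_ne_zero_of_injective he h1 (p := p - 1) (r := r) (q := q) (s := s - 1)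
    (by simp only [LinearMap.sub_apply, Module.End.one_apply, hC₁]; module)
    (by simp only [LinearMap.sub_apply, Module.End.one_apply, hC₂]; module)
  have d3 := det_ne_zero_of_injective he h3 (p := p - l) (r := r) (q := q) (s := s - m)
    (by simp only [LinearMap.sub_apply, hC₁, hA₁]; module)
    (by simp only [LinearMap.sub_apply, hC₂, hA₂]; module)
  obtain ⟨v0, v1, v2, v3, v4⟩ := hf.vanishesOn hB hLB e₁ e₂
  simp only [hA₁, hA₂, map_smul] at v3
  simp only [hC₁, hC₂, map_smul, map_add] at v4
  obtain ⟨v, hv⟩ := hns.exists_ne_zero hB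
  refine hv (cubic_eq_zero_of_five_graphs hB hl0 hl1 hm0 hm1 (sub_ne_zero.2 hlm) hq hr d0 d1 d3
    v0 v1 v2 v3 v4 v ?_)
  obtain ⟨x, y, z, w, rfl⟩ := hf.isFrame.exists_combination hU he v
  refine add_mem (add_mem (smul_mem _ _ ?_) (smul_mem _ _ ?_))
    (add_mem (smul_mem _ _ ?_) (smul_mem _ _ ?_)) <;> exact subset_span (by simp)

/-- A line of a real cubic in conjugate complex coordinates. -/
theorem VanishesOn.complex_pair {F : MvPolynomial (Fin 4) ℝ} {x y : V4}
    (h : VanishesOn (polarForm F) x y) :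
    VanishesOn (polarForm (MvPolynomial.map (algebraMap ℝ ℂ) F))
      (complexify x - Complex.I • complexify y) (complexify x + Complex.I • complexify y) := by
  have hc : VanishesOn (polarForm (MvPolynomial.map (algebraMap ℝ ℂ) F)) (complexify x)
      (complexify y) := by
    obtain ⟨h0, h1, h2, h3⟩ := h
    refine ⟨?_, ?_, ?_, ?_⟩ <;> rw [polarForm_complexify]
    exacts [by rw [h0]; rfl, by rw [h1]; rfl, by rw [h2]; rfl, by rw [h3]; rfl]
  have := hc.comb (polarForm_isSymmTrilinear _) 1 (-Complex.I) 1 Complex.I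
  simpa [sub_eq_add_neg] using this

theorem mem_of_conjugate_combinations {M : Type*} [AddCommGroup M] [Module ℂ M]
    {W : Submodule ℂ M} {z w : M} (h₁ : z - Complex.I • w ∈ W) (h₂ : z + Complex.I • w ∈ W) :
    z ∈ W ∧ w ∈ W := by
  have hz : z ∈ W := by
    have h : z = (2⁻¹ : ℂ) • ((z - Complex.I • w) + (z + Complex.I • w)) := by module
    rw [h]
    exact W.smul_mem _ (W.add_mem h₁ h₂)
  exact ⟨hz, (W.smul_mem_iff Complex.I_ne_zero).1 ((W.add_mem_iff_right hz).1 h₂)⟩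

theorem commute_of_complex_eigenvalues {F : MvPolynomial (Fin 4) ℝ}
    (hns : Nonsingular (polarForm F)) (hU : Module.finrank ℝ U = 2) (hL : PairwiseSkew L)
    (hLB : ∀ i, LiesOn (polarForm F) (L i)) (hf : FramedLines a b A C L) {e₁ e₂ : U}
    (he : LinearIndependent ℝ ![e₁, e₂]) {p ω : ℝ} (hω : ω ≠ 0)
    (hA₁ : A e₁ = p • e₁ + ω • e₂) (hA₂ : A e₂ = (-ω) • e₁ + p • e₂) :
    ∃ r t : ℝ, C e₁ = r • e₁ + t • e₂ ∧ C e₂ = (-t) • e₁ + r • e₂ := by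
  have hB := polarForm_isSymmTrilinear F
  obtain ⟨r, t, hC₁⟩ := exists_eq_combination hU he (C e₁)
  obtain ⟨s, u, hC₂⟩ := exists_eq_combination hU he (C e₂)
  by_cases hR : r - u = 0 ∧ s + t = 0
  · refine ⟨r, t, hC₁, ?_⟩
    rw [hC₂, sub_eq_zero.1 hR.1, eq_neg_of_add_eq_zero_left hR.2]
  exfalso
  obtain ⟨-, -, h0, h1, h3⟩ := hf.injective hL
  have d0 := det_ne_zero_of_injective he h0 (p := r) (r := t) (q := s) (s := u)
    (by simp [hC₁]) (by simp [hC₂])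
  have d1 := det_ne_zero_of_injective he h1 (p := r - 1) (r := t) (q := s) (s := u - 1)
    (by simp only [LinearMap.sub_apply, Module.End.one_apply, hC₁]; module)
    (by simp only [LinearMap.sub_apply, Module.End.one_apply, hC₂]; module)
  have d3 := det_ne_zero_of_injective he h3 (p := r - p) (r := t - ω) (q := s + ω) (s := u - p)
    (by simp only [LinearMap.sub_apply, hC₁, hA₁]; module)
    (by simp only [LinearMap.sub_apply, hC₂, hA₂]; module)
  obtain ⟨v0, v1, v2, v3, v4⟩ := hf.vanishesOn hB hLB e₁ e₂
  simp only [hA₁, hA₂, map_smul, map_add] at v3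
  simp only [hC₁, hC₂, map_smul, map_add] at v4
  obtain ⟨v, hv⟩ := hns.exists_ne_zero hB
  have hI : Complex.I ^ 2 = -1 := Complex.I_sq
  have hω' : (ω : ℂ) ≠ 0 := by exact_mod_cast hω
  have hdet : ∀ {x : ℝ} {z : ℂ}, x ≠ 0 → z = x → z ≠ 0 := by
    rintro x _ hx rfl
    exact_mod_cast hx
  have him : ∀ {x y : ℝ}, y ≠ 0 → (x : ℂ) + Complex.I * y ≠ 0 := by
    intro x y hy h
    exact hy (by simpa using congrArg Complex.im h)
  have him' : ∀ {x y : ℝ}, ¬ (x = 0 ∧ y = 0) → (x + Complex.I * y : ℂ) / 2 ≠ 0 := by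
    intro x y hxy h
    have h := (div_eq_zero_iff.1 h).resolve_right two_ne_zero
    exact hxy ⟨by simpa using congrArg Complex.re h, by simpa using congrArg Complex.im h⟩
  set x₁ := a e₁
  set x₂ := a e₂
  set y₁ := b e₁
  set y₂ := b e₂
  have key := cubic_eq_zero_of_five_graphs
    (B := polarForm (MvPolynomial.map (algebraMap ℝ ℂ) F)) (polarForm_isSymmTrilinear _)
    (a₁ := complexify x₁ - Complex.I • complexify x₂)
    (a₂ := complexify x₁ + Complex.I • complexify x₂)
    (b₁ := complexify y₁ - Complex.I • complexify y₂)
    (b₂ := complexify y₁ + Complex.I • complexify y₂)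
    (l := p + Complex.I * ω) (m := p + Complex.I * (-ω : ℝ))
    (p := ((r + u : ℝ) + Complex.I * (t - s : ℝ)) / 2)
    (q := ((r - u : ℝ) + Complex.I * (s + t : ℝ)) / 2)
    (r := ((r - u : ℝ) + Complex.I * (-(s + t) : ℝ)) / 2)
    (s := ((r + u : ℝ) + Complex.I * (s - t : ℝ)) / 2)
    (him hω) ?_ (him (neg_ne_zero.2 hω)) ?_ ?_ (him' hR) (him' fun h => hR ⟨h.1, neg_eq_zero.1 h.2⟩)
    (hdet d0 ?_) (hdet d1 ?_) (hdet d3 ?_) (VanishesOn.complex_pair v0) (VanishesOn.complex_pair v1) ?_ ?_ ?_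
    (complexify v) ?_
  · rw [polarForm_complexify] at key
    exact hv (by exact_mod_cast key)
  · intro h
    exact hω (by simpa using congrArg Complex.im h)
  · intro h
    exact hω (by simpa using congrArg Complex.im h)
  · rw [show (p + Complex.I * ω : ℂ) - (p + Complex.I * (-ω : ℝ)) = 2 * (Complex.I * ω) by
      push_cast; ring]
    exact mul_ne_zero two_ne_zero (mul_ne_zero Complex.I_ne_zero hω')
  · push_cast
    linear_combination (((t - s : ℂ) * (s - t) + (s + t) ^ 2) / 4) * hI
  · push_cast
    linear_combination (((t - s : ℂ) * (s - t) + (s + t) ^ 2) / 4) * hI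
  · push_cast
    linear_combination ((((t - s) / 2 - ω) * ((s - t) / 2 + ω) + (s + t) ^ 2 / 4 : ℂ)) * hI
  · convert (VanishesOn.complex_pair v2) using 1
    · simp only [map_add]
      module
    · simp only [map_add]
      module
  · convert (VanishesOn.complex_pair v3) using 1
    · ext i
      simp [complexify_apply]
      linear_combination (-ω * (y₂ i : ℂ)) * hI
    · ext i
      simp [complexify_apply]
      linear_combination (-ω * (y₂ i : ℂ)) * hI
  · convert (VanishesOn.complex_pair v4) using 1
    · ext i
      simp [complexify_apply]
      linear_combination (-t * (y₂ i : ℂ)) * hI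
    · ext i
      simp [complexify_apply]
      linear_combination (-t * (y₂ i : ℂ)) * hI
  · obtain ⟨x, y, z, w, rfl⟩ := hf.isFrame.exists_combination hU he v
    simp only [map_add, map_smul]
    set W := span ℂ {complexify x₁ - Complex.I • complexify x₂,
      complexify x₁ + Complex.I • complexify x₂, complexify y₁ - Complex.I • complexify y₂,
      complexify y₁ + Complex.I • complexify y₂}
    have hx := mem_of_conjugate_combinations (W := W) (z := complexify x₁) (w := complexify x₂)
      (subset_span (by simp)) (subset_span (by simp))
    have hy := mem_of_conjugate_combinations (W := W) (z := complexify y₁) (w := complexify y₂)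
      (subset_span (by simp)) (subset_span (by simp))
    have hs : ∀ (c : ℝ) {z : Fin 4 → ℂ}, z ∈ W → c • z ∈ W := fun c z hz => W.smul_mem (c : ℂ) hz
    exact add_mem (add_mem (hs x hx.1) (hs y hx.2)) (add_mem (hs z hy.1) (hs w hy.2))

/-- Five skew lines on a nonsingular real cubic surface with fifteen real lines are graphs of
complex scalars, for a suitable complex structure. -/
theorem exists_complex_basis {F : MvPolynomial (Fin 4) ℝ} (hns : Nonsingular (polarForm F))
    (h15 : {P | LiesOn (polarForm F) P}.ncard = 15) (hU : Module.finrank ℝ U = 2)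
    (hL : PairwiseSkew L) (hLB : ∀ i, LiesOn (polarForm F) (L i))
    (hf : FramedLines a b A C L) :
    ∃ e₁ e₂ : U, LinearIndependent ℝ ![e₁, e₂] ∧ ∃ p ω r t : ℝ,
      (A e₁ = p • e₁ + ω • e₂ ∧ A e₂ = (-ω) • e₁ + p • e₂) ∧
      C e₁ = r • e₁ + t • e₂ ∧ C e₂ = (-t) • e₁ + r • e₂ := by
  have hB := polarForm_isSymmTrilinear F
  obtain ⟨e₁, e₂, he, h⟩ := plane_endomorphism_trichotomy hU A
  obtain ⟨l, m, hlm, hA₁, hA₂⟩ | ⟨l, c, hA₁, hA₂⟩ | ⟨p, ω, hω, hA₁, hA₂⟩ := h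
  · exact (hns.no_distinct_eigenvalues hB h15 hU hL hLB hf he hlm hA₁ hA₂).elim
  · obtain ⟨hl0, hl1⟩ := hf.eigenvalue_ne hL (he.ne_zero 0) hA₁
    obtain ⟨v0, v1, v2, v3, -⟩ := hf.vanishesOn hB hLB e₁ e₂
    simp only [hA₁, hA₂, map_smul, map_add] at v3
    exact (hns.no_double_transversal hB (hf.isFrame.linearIndependent_left he)
      (hf.isFrame.exists_combination hU he) hl0 hl1 v0 v1 v2 v3).elim
  · obtain ⟨r, t, hC⟩ := commute_of_complex_eigenvalues hns hU hL hLB hf he hω hA₁ hA₂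
    exact ⟨e₁, e₂, he, p, ω, r, t, ⟨hA₁, hA₂⟩, hC⟩

end NormalForm

section InvertibleMatrices

open Matrix

theorem joinedIn_mul {A A' B B' : Matrix (Fin 4) (Fin 4) ℝ}
    (hA : JoinedIn {M : Matrix (Fin 4) (Fin 4) ℝ | M.det ≠ 0} A A')
    (hB : JoinedIn {M : Matrix (Fin 4) (Fin 4) ℝ | M.det ≠ 0} B B') :
    JoinedIn {M : Matrix (Fin 4) (Fin 4) ℝ | M.det ≠ 0} (A * B) (A' * B') := by
  obtain ⟨γ, hγ⟩ := hA
  obtain ⟨δ, hδ⟩ := hB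
  refine ⟨⟨⟨fun t => γ t * δ t, by fun_prop⟩, by simp, by simp⟩, fun t => ?_⟩
  simpa using ⟨hγ t, hδ t⟩

theorem joinedIn_of_continuous {f : ℝ → Matrix (Fin 4) (Fin 4) ℝ} (hf : Continuous f)
    (hdet : ∀ t ∈ Set.Icc (0 : ℝ) 1, (f t).det ≠ 0) :
    JoinedIn {M : Matrix (Fin 4) (Fin 4) ℝ | M.det ≠ 0} (f 0) (f 1) :=
  JoinedIn.ofLine hf.continuousOn rfl rfl (by
    rintro _ ⟨t, ht, rfl⟩
    exact hdet t ht)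

/-- The diagonal matrix with `x` in position `i` and `1` elsewhere. -/
def dilation (i : Fin 4) (x : ℝ) : Matrix (Fin 4) (Fin 4) ℝ :=
  diagonal (Function.update 1 i x)

theorem det_dilation (i : Fin 4) (x : ℝ) : (dilation i x).det = x := by
  rw [dilation, det_diagonal, Finset.prod_update_of_mem (Finset.mem_univ i)]
  simp

theorem dilation_mul (i : Fin 4) (x y : ℝ) : dilation i x * dilation i y = dilation i (x * y) := by
  rw [dilation, dilation, dilation, diagonal_mul_diagonal]
  congr 1
  ext j
  by_cases h : j = i
  · subst h
    simp
  · simp [h]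

theorem dilation_one (i : Fin 4) : dilation i 1 = 1 := by
  rw [dilation, show (1 : ℝ) = (1 : Fin 4 → ℝ) i from rfl, Function.update_eq_self]
  exact diagonal_one

theorem diagonal_eq_prod_dilation (d : Fin 4 → ℝ) :
    diagonal d = dilation 0 (d 0) * dilation 1 (d 1) * dilation 2 (d 2) * dilation 3 (d 3) := by
  simp only [dilation, diagonal_mul_diagonal]
  congr 1
  ext j
  fin_cases j <;> simp [Function.update]

theorem joinedIn_dilation (i : Fin 4) {x y : ℝ} (h : 0 < x * y) :
    JoinedIn {M : Matrix (Fin 4) (Fin 4) ℝ | M.det ≠ 0} (dilation i x) (dilation i y) := by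
  have := joinedIn_of_continuous (f := fun t => dilation i ((1 - t) * x + t * y))
    (by unfold dilation; fun_prop) ?_
  · simpa using this
  · rintro t ⟨ht0, ht1⟩
    rw [det_dilation]
    intro h0
    have hx : 0 < x ^ 2 := by
      have : x ≠ 0 := by
        rintro rfl
        simp at h
      positivity
    have h1 : (1 - t) * x ^ 2 + t * (x * y) = 0 := by linear_combination x * h0
    rcases ht1.lt_or_eq with ht | rfl
    · nlinarith [mul_nonneg ht0 h.le, mul_pos (sub_pos.2 ht) hx]
    · nlinarith

theorem joinedIn_dilation_neg_one (i : Fin 4) :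
    JoinedIn {M : Matrix (Fin 4) (Fin 4) ℝ | M.det ≠ 0} (dilation 0 (-1)) (dilation i (-1)) := by
  by_cases hi : i = 0
  · subst hi
    exact JoinedIn.refl (by simp [det_dilation])
  let v : ℝ → Fin 4 → ℝ := fun t => Real.cos (t * (Real.pi / 2)) • Pi.single 0 1 +
    Real.sin (t * (Real.pi / 2)) • Pi.single i 1
  have hv : ∀ t, v t ⬝ᵥ v t = 1 := by
    intro t
    have := Real.sin_sq_add_cos_sq (t * (Real.pi / 2))
    simp [v, hi, Ne.symm hi]
    linear_combination this
  have hone : ∀ j : Fin 4, 1 + vecMulVec ((-2 : ℝ) • Pi.single j 1) (Pi.single j 1) =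
      dilation j (-1) := by
    intro j
    ext k l
    by_cases hk : k = j <;> by_cases hl : l = j <;> by_cases hkl : k = l <;>
      simp_all [dilation, vecMulVec_apply, one_apply]
    all_goals norm_num
  have := joinedIn_of_continuous (f := fun t => 1 + vecMulVec ((-2 : ℝ) • v t) (v t))
    (by
      refine continuous_const.add (continuous_matrix fun k l => ?_)
      simp only [vecMulVec_apply, v, Pi.smul_apply, Pi.add_apply, smul_eq_mul]
      fun_prop) ?_
  · have hv0 : v 0 = Pi.single 0 1 := by simp [v]
    have hv1 : v 1 = Pi.single i 1 := by simp [v]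
    simpa only [hv0, hv1, hone] using this
  · intro t _
    rw [vecMulVec_eq Unit, det_one_add_replicateCol_mul_replicateRow, dotProduct_smul, hv]
    norm_num

theorem exists_joinedIn_dilation {M : Matrix (Fin 4) (Fin 4) ℝ} (hM : M.det ≠ 0) :
    ∃ ε : ℝ, (ε = 1 ∨ ε = -1) ∧
      JoinedIn {M : Matrix (Fin 4) (Fin 4) ℝ | M.det ≠ 0} (dilation 0 ε) M := by
  have hmul : ∀ A B : Matrix (Fin 4) (Fin 4) ℝ,
      (∃ ε : ℝ, (ε = 1 ∨ ε = -1) ∧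
        JoinedIn {M : Matrix (Fin 4) (Fin 4) ℝ | M.det ≠ 0} (dilation 0 ε) A) →
      (∃ ε : ℝ, (ε = 1 ∨ ε = -1) ∧
        JoinedIn {M : Matrix (Fin 4) (Fin 4) ℝ | M.det ≠ 0} (dilation 0 ε) B) →
      ∃ ε : ℝ, (ε = 1 ∨ ε = -1) ∧
        JoinedIn {M : Matrix (Fin 4) (Fin 4) ℝ | M.det ≠ 0} (dilation 0 ε) (A * B) := by
    rintro A B ⟨ε, hε, hA⟩ ⟨δ, hδ, hB⟩
    refine ⟨ε * δ, ?_, dilation_mul 0 ε δ ▸ joinedIn_mul hA hB⟩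
    rcases hε with rfl | rfl <;> rcases hδ with rfl | rfl <;> simp
  refine diagonal_transvection_induction_of_det_ne_zero _ M hM (fun d hd => ?_) (fun t => ?_)
    fun A B _ _ => hmul A B
  · have hdil : ∀ i, ∃ ε : ℝ, (ε = 1 ∨ ε = -1) ∧
        JoinedIn {M : Matrix (Fin 4) (Fin 4) ℝ | M.det ≠ 0} (dilation 0 ε)
          (dilation i (d i)) := by
      intro i
      have hdi : d i ≠ 0 := by
        rw [det_diagonal] at hd
        exact Finset.prod_ne_zero_iff.1 hd i (Finset.mem_univ i)
      rcases hdi.lt_or_gt with h | h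
      · exact ⟨-1, Or.inr rfl, (joinedIn_dilation_neg_one i).trans
          (joinedIn_dilation i (by simpa using h))⟩
      · refine ⟨1, Or.inl rfl, ?_⟩
        rw [dilation_one, ← dilation_one i]
        exact joinedIn_dilation i (by simpa using h)
    rw [diagonal_eq_prod_dilation]
    exact hmul _ _ (hmul _ _ (hmul _ _ (hdil 0) (hdil 1)) (hdil 2)) (hdil 3)
  · refine ⟨1, Or.inl rfl, ?_⟩
    have := joinedIn_of_continuous (f := fun s => transvection t.i t.j (s * t.c))
      (by
        refine continuous_const.add (continuous_matrix fun k l => ?_)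
        simp only [single_apply]
        split_ifs <;> fun_prop)
      fun s _ => by simp [det_transvection_of_ne _ _ t.hij]
    simpa [dilation_one, TransvectionStruct.toMatrix] using this

/-- Matrices of positive determinant are connected to the identity. -/
theorem joinedIn_one_of_det_pos {M : Matrix (Fin 4) (Fin 4) ℝ} (hM : 0 < M.det) :
    JoinedIn {M : Matrix (Fin 4) (Fin 4) ℝ | M.det ≠ 0} 1 M := by
  obtain ⟨ε, rfl | rfl, h⟩ := exists_joinedIn_dilation hM.ne'
  · rwa [dilation_one] at h
  · obtain ⟨γ, hγ⟩ := h
    obtain ⟨t, ht⟩ := intermediate_value_univ (f := fun t => (γ t).det) 0 1 (by fun_prop)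
      (show (0 : ℝ) ∈ _ by simp [det_dilation, hM.le])
    exact (hγ t ht).elim

end InvertibleMatrices

section ComplexLines

variable {Ψ : ℂ × ℂ →ₗ[ℝ] V4}

/-- The image under `Ψ` of the complex line through `p`. -/
def complexLine (Ψ : ℂ × ℂ →ₗ[ℝ] V4) (p : ℂ × ℂ) : PLine :=
  span ℝ {Ψ p, Ψ (Complex.I • p)}

theorem mem_complexLine {p : ℂ × ℂ} {v : V4} :
    v ∈ complexLine Ψ p ↔ ∃ c : ℂ, v = Ψ (c • p) := by
  have h : ∀ s t : ℝ, s • Ψ p + t • Ψ (Complex.I • p) = Ψ ((s + t * Complex.I : ℂ) • p) := by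
    intro s t
    rw [← map_smul, ← map_smul, ← map_add, add_smul, mul_smul]
    rfl
  rw [complexLine, mem_span_pair]
  constructor
  · rintro ⟨s, t, rfl⟩
    exact ⟨_, h s t⟩
  · rintro ⟨c, rfl⟩
    exact ⟨c.re, c.im, by rw [h, Complex.re_add_im]⟩

theorem complexLine_smul {c : ℂ} (hc : c ≠ 0) (p : ℂ × ℂ) :
    complexLine Ψ (c • p) = complexLine Ψ p := by
  ext v
  simp only [mem_complexLine, smul_smul]
  constructor
  · rintro ⟨d, rfl⟩
    exact ⟨_, rfl⟩
  · rintro ⟨d, rfl⟩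
    exact ⟨d / c, by rw [div_mul_cancel₀ d hc]⟩

theorem map_complexLine (A : V4 →ₗ[ℝ] V4) (p : ℂ × ℂ) :
    (complexLine Ψ p).map A = complexLine (A ∘ₗ Ψ) p := by
  rw [complexLine, map_span, Set.image_pair]
  rfl

theorem isLine_complexLine (hΨ : Function.Injective Ψ) {p : ℂ × ℂ} (hp : p ≠ 0) :
    IsLine (complexLine Ψ p) := by
  refine isLine_span_pair (LinearIndependent.pair_iff.2 fun s t h => ?_)
  rw [← map_smul, ← map_smul, ← map_add, map_eq_zero_iff _ hΨ] at h
  have h' : (s + t * Complex.I : ℂ) • p = 0 := by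
    rw [← h, add_smul, mul_smul]
    rfl
  have h0 := (smul_eq_zero.1 h').resolve_right hp
  exact ⟨by simpa using congrArg Complex.re h0, by simpa using congrArg Complex.im h0⟩

theorem skew_complexLine (hΨ : Function.Injective Ψ) {z w : ℂ} (hzw : z ≠ w) :
    Skew (complexLine Ψ (1, z)) (complexLine Ψ (1, w)) := by
  refine ⟨isLine_complexLine hΨ (by simp), isLine_complexLine hΨ (by simp),
    (Submodule.eq_bot_iff _).2 ?_⟩
  rintro v ⟨h1, h2⟩
  obtain ⟨c, rfl⟩ := mem_complexLine.1 h1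
  obtain ⟨d, hd⟩ := mem_complexLine.1 h2
  have h := hΨ hd
  simp only [Prod.smul_mk, smul_eq_mul, mul_one, Prod.mk.injEq] at h
  obtain ⟨rfl, h⟩ := h
  have hc : c = 0 := by
    by_contra hc
    exact hzw (mul_left_cancel₀ hc h)
  simp [hc]

theorem det_ne_zero_of_skew_complexLine {p q : ℂ × ℂ} (hΨ : Function.Injective Ψ) (hp : p ≠ 0)
    (hq : q ≠ 0) (h : Skew (complexLine Ψ p) (complexLine Ψ q)) :
    p.1 * q.2 - q.1 * p.2 ≠ 0 := by
  intro h0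
  have key : ∀ c d : ℂ, c • p = d • q → c = 0 := by
    intro c d hcd
    have hmem : Ψ (c • p) ∈ complexLine Ψ p ⊓ complexLine Ψ q :=
      ⟨mem_complexLine.2 ⟨c, rfl⟩, mem_complexLine.2 ⟨d, by rw [hcd]⟩⟩
    rw [h.2.2, Submodule.mem_bot, map_eq_zero_iff _ hΨ] at hmem
    exact (smul_eq_zero.1 hmem).resolve_right hp
  have h1 := key q.1 p.1 (Prod.ext (mul_comm _ _) (by
    simp only [Prod.smul_snd, smul_eq_mul]
    linear_combination -h0))
  have h2 := key q.2 p.2 (Prod.ext (by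
    simp only [Prod.smul_fst, smul_eq_mul]
    linear_combination h0) (mul_comm _ _))
  exact hq (Prod.ext h1 h2)

/-- Complex lines whose slopes have distinct imaginary parts can be moved to real slopes,
simultaneously with a motion of the ambient complex structure. -/
theorem deformation_complexLine {n : ℕ} {Φ : ℝ → ℂ × ℂ →ₗ[ℝ] V4}
    (hΦ : ∀ p, Continuous fun t => Φ t p)
    (hinj : ∀ t ∈ Set.Icc (0 : ℝ) 1, Function.Injective (Φ t)) {w : Fin n → ℂ} {x : Fin n → ℝ}
    (hw : ∀ i j, i ≠ j → (w i - w j).im ≠ 0) (hx : Function.Injective x) :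
    Deformation (fun i => complexLine (Φ 0) (1, w i))
      (fun i => complexLine (Φ 1) (1, (x i : ℂ))) := by
  let u : ℝ → Fin n → ℂ := fun t i => (1 - t : ℝ) * w i + (t * x i : ℝ)
  have hcont : ∀ f g : ℝ → ℂ, Continuous f → Continuous g →
      Continuous fun t => Φ t (f t, g t) := by
    intro f g hf hg
    have : ∀ t, Φ t (f t, g t) = (f t).re • Φ t (1, 0) + (f t).im • Φ t (Complex.I, 0) +
        ((g t).re • Φ t (0, 1) + (g t).im • Φ t (0, Complex.I)) := by
      intro t
      rw [← map_smul, ← map_smul, ← map_smul, ← map_smul, ← map_add, ← map_add, ← map_add]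
      congr 1
      ext <;> simp
    simp only [this]
    have h1 := Complex.continuous_re.comp hf
    have h2 := Complex.continuous_im.comp hf
    have h3 := Complex.continuous_re.comp hg
    have h4 := Complex.continuous_im.comp hg
    exact ((h1.smul (hΦ _)).add (h2.smul (hΦ _))).add ((h3.smul (hΦ _)).add (h4.smul (hΦ _)))
  have hu : ∀ i, Continuous fun t => u t i := fun i => by
    simp only [u]
    fun_prop
  refine ⟨fun t i => complexLine (Φ t) (1, u t i), fun i => ?_, fun t ht i j hij => ?_, ?_, ?_⟩
  · refine ⟨fun t => Φ t (1, u t i), fun t => Φ t (Complex.I • (1, u t i)),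
      (hcont _ _ continuous_const (hu i)).continuousOn,
      (hcont (fun _ => Complex.I • 1) (fun t => Complex.I • u t i) continuous_const
        ((hu i).const_smul Complex.I)).continuousOn, fun t _ => rfl⟩
  · refine skew_complexLine (hinj t ht) fun h => ?_
    have him : (1 - t) * (w i - w j).im = 0 := by
      have := congrArg Complex.im h
      simp only [u, Complex.add_im, Complex.im_ofReal_mul, Complex.ofReal_im] at this
      simp only [Complex.sub_im]
      linear_combination this
    have ht1 := (mul_eq_zero.1 him).resolve_right (hw i j hij)
    have ht1 : t = 1 := by linarith
    subst ht1
    exact hij (hx (by simpa [u] using h))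
  · simp [u]
  · simp [u]

theorem exists_forall_add_mul_ne_zero {K ι : Type*} [Field K] [Infinite K] [Finite ι]
    {x y : ι → K} (h : ∀ i, x i = 0 → y i ≠ 0) : ∃ k : K, ∀ i, x i + k * y i ≠ 0 := by
  have hfin : (⋃ i, {k : K | x i + k * y i = 0}).Finite := by
    refine Set.finite_iUnion fun i => Set.Subsingleton.finite fun k hk l hl => ?_
    simp only [Set.mem_ofPred_eq] at hk hl
    have hy : y i ≠ 0 := fun hy => h i (by simpa [hy] using hk) hy
    exact mul_right_cancel₀ hy (by linear_combination hk - hl)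
  obtain ⟨k, hk⟩ := hfin.infinite_compl.nonempty
  exact ⟨k, fun i hi => hk (Set.mem_iUnion.2 ⟨i, hi⟩)⟩

/-- A change of complex coordinates brings pairwise distinct complex lines to affine form with
slopes having distinct imaginary parts. -/
theorem exists_affine_slopes {n : ℕ} (hΨ : Function.Injective Ψ) {p : Fin n → ℂ × ℂ}
    (hp : ∀ i, p i ≠ 0) (hskew : PairwiseSkew fun i => complexLine Ψ (p i)) :
    ∃ (Φ : ℂ × ℂ →ₗ[ℝ] V4) (w : Fin n → ℂ), Function.Injective Φ ∧
      (∀ i j, i ≠ j → (w i - w j).im ≠ 0) ∧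
      ∀ i, complexLine Ψ (p i) = complexLine Φ (1, w i) := by
  obtain ⟨k, hk⟩ := exists_forall_add_mul_ne_zero (x := fun i => (p i).1)
    (y := fun i => (p i).2) fun i h1 h2 => hp i (Prod.ext h1 h2)
  set v : Fin n → ℂ := fun i => (p i).2 / ((p i).1 + k * (p i).2) with hv
  have hvij : ∀ i j, i ≠ j → v i ≠ v j := by
    intro i j hij h
    rw [hv, div_eq_div_iff (hk i) (hk j)] at h
    exact det_ne_zero_of_skew_complexLine hΨ (hp i) (hp j) (hskew i j hij)
      (by linear_combination -h)
  obtain ⟨s, hs⟩ := exists_forall_add_mul_ne_zero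
    (x := fun ij : {ij : Fin n × Fin n // ij.1 ≠ ij.2} => (v ij.1.1 - v ij.1.2).re)
    (y := fun ij => (v ij.1.1 - v ij.1.2).im)
    fun ij h1 h2 => hvij _ _ ij.2 (sub_eq_zero.1 (Complex.ext h1 h2))
  have hc : (s + Complex.I : ℂ) ≠ 0 := fun h => by simpa using congrArg Complex.im h
  set c : ℂ := s + Complex.I with hc'
  let g : ℂ × ℂ →ₗ[ℝ] ℂ × ℂ :=
    { toFun := fun q => (q.1 - k * (q.2 / c), q.2 / c)
      map_add' := fun q q' => by
        ext1
        · simp only [Prod.fst_add, Prod.snd_add]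
          ring
        · simp only [Prod.snd_add]
          ring
      map_smul' := fun r q => by
        ext1
        · simp only [Prod.smul_fst, Prod.smul_snd, Complex.real_smul, RingHom.id_apply]
          ring
        · simp only [Prod.smul_snd, Complex.real_smul, RingHom.id_apply]
          ring }
  have hg : Function.Injective g := by
    rw [injective_iff_map_eq_zero]
    intro q hq
    have h2 : q.2 / c = 0 := congrArg Prod.snd hq
    have h1 : q.1 - k * (q.2 / c) = 0 := congrArg Prod.fst hq
    rw [h2, mul_zero, sub_zero] at h1
    exact Prod.ext h1 ((div_eq_zero_iff.1 h2).resolve_right hc)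
  refine ⟨Ψ ∘ₗ g, fun i => c * v i, hΨ.comp hg, fun i j hij => ?_, fun i => ?_⟩
  · have := hs ⟨(i, j), hij⟩
    rw [← mul_sub, hc', Complex.mul_im]
    simpa [add_comm] using this
  · have hpi : p i = ((p i).1 + k * (p i).2) • g (1, c * v i) := by
      ext1
      · simp only [g, hv, LinearMap.coe_mk, AddHom.coe_mk, Prod.smul_fst, smul_eq_mul]
        rw [mul_div_cancel_left₀ _ hc]
        linear_combination k * mul_div_cancel₀ (p i).2 (hk i)
      · simp only [g, hv, LinearMap.coe_mk, AddHom.coe_mk, Prod.smul_snd, smul_eq_mul]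
        rw [mul_div_cancel_left₀ _ hc, mul_div_cancel₀ _ (hk i)]
    have hgI : ∀ q, g (Complex.I • q) = Complex.I • g q := by
      intro q
      ext1
      · simp only [g, LinearMap.coe_mk, AddHom.coe_mk, Prod.smul_fst, Prod.smul_snd, smul_eq_mul]
        ring
      · simp only [g, LinearMap.coe_mk, AddHom.coe_mk, Prod.smul_snd, smul_eq_mul]
        ring
    rw [hpi, complexLine_smul (hk i), complexLine, complexLine, LinearMap.comp_apply,
      LinearMap.comp_apply, hgI]

/-- The complex structure on `ℝ⁴` for which the lines of the join configuration of the identity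
are complex lines with real slopes. -/
def joinFrame : ℂ × ℂ →ₗ[ℝ] V4 where
  toFun q := ![q.1.re, q.2.re, q.2.im, q.1.im]
  map_add' q q' := by
    ext i
    fin_cases i <;> simp
  map_smul' r q := by
    ext i
    fin_cases i <;> simp

theorem joinFrame_injective : Function.Injective joinFrame := by
  rw [injective_iff_map_eq_zero]
  intro q hq
  have h : ∀ i, joinFrame q i = 0 := fun i => by rw [hq]; rfl
  exact Prod.ext (Complex.ext (h 0) (h 3)) (Complex.ext (h 1) (h 2))

theorem joinConfig_refl_eq {n : ℕ} :
    joinConfig (Equiv.refl (Fin n)) =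
      fun i => complexLine joinFrame (1, ((i.val + 1 : ℝ) : ℂ)) := by
  funext i
  simp [joinConfig, complexLine, joinFrame]

theorem exists_linearEquiv_comp_eq {Φ Φ' : ℂ × ℂ →ₗ[ℝ] V4} (hΦ : Function.Injective Φ)
    (hΦ' : Function.Injective Φ') : ∃ N : V4 ≃ₗ[ℝ] V4, ∀ q, N (Φ q) = Φ' q := by
  have hrank : Module.finrank ℝ (ℂ × ℂ) = Module.finrank ℝ V4 := by
    simp [Complex.finrank_real_complex]
  refine ⟨(LinearMap.linearEquivOfInjective Φ hΦ hrank).symm.trans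
    (LinearMap.linearEquivOfInjective Φ' hΦ' hrank), fun q => ?_⟩
  rw [LinearEquiv.trans_apply, ← LinearMap.linearEquivOfInjective_apply (f := Φ) (hf := hΦ)
    (hdim := hrank), LinearEquiv.symm_apply_apply, LinearMap.linearEquivOfInjective_apply]

/-- Complex lines form a configuration coarse deformation equivalent to the standard join. -/
theorem coarseDeformEquiv_joinConfig {n : ℕ} (hΨ : Function.Injective Ψ) {p : Fin n → ℂ × ℂ}
    (hp : ∀ i, p i ≠ 0) (hskew : PairwiseSkew fun i => complexLine Ψ (p i)) :
    CoarseDeformEquiv (fun i => complexLine Ψ (p i)) (joinConfig (Equiv.refl (Fin n))) := by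
  obtain ⟨Φ, w, hΦ, hw, hline⟩ := exists_affine_slopes hΨ hp hskew
  have hx : Function.Injective fun i : Fin n => (i.val + 1 : ℝ) := fun i j h => by
    simpa [Fin.ext_iff] using h
  obtain ⟨N, hN⟩ := exists_linearEquiv_comp_eq hΦ joinFrame_injective
  rw [joinConfig_refl_eq]
  simp only [hline]
  have hdet0 : LinearMap.det (N : V4 →ₗ[ℝ] V4) ≠ 0 := (LinearEquiv.isUnit_det' N).ne_zero
  rcases hdet0.lt_or_gt with hdet | hdet
  · refine Or.inr ⟨fun i => complexLine Φ (1, ((i.val + 1 : ℝ) : ℂ)), ⟨N.symm, ?_, fun i => ?_⟩,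
      1, 1, ?_⟩
    · have h : LinearMap.det (N.symm : V4 →ₗ[ℝ] V4) * LinearMap.det (N : V4 →ₗ[ℝ] V4) = 1 :=
        LinearEquiv.det_symm_mul_det N
      by_contra! h0
      nlinarith
    · have hcomp : (N.symm : V4 →ₗ[ℝ] V4) ∘ₗ joinFrame = Φ :=
        LinearMap.ext fun q => N.symm_apply_eq.2 (hN q).symm
      rw [map_complexLine, hcomp]
    · exact deformation_complexLine (Φ := fun _ => Φ) (fun p => continuous_const)
        (fun _ _ => hΦ) hw hx
  · refine Or.inl ⟨1, 1, ?_⟩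
    rw [← LinearMap.det_toMatrix'] at hdet
    obtain ⟨γ, hγ⟩ := joinedIn_one_of_det_pos hdet
    have h := deformation_complexLine (Φ := fun t => Matrix.toLin' (γ.extend t) ∘ₗ Φ)
      (fun q => ?_) (fun t ht => ?_) hw hx
    · have h0 : Matrix.toLin' (γ.extend 0) ∘ₗ Φ = Φ := by simp
      have h1 : Matrix.toLin' (γ.extend 1) ∘ₗ Φ = joinFrame :=
        LinearMap.ext fun q => by simp [hN]
      rwa [h0, h1] at h
    · exact γ.continuous_extend.matrix_mulVec continuous_const
    · have hdet : (γ.extend t).det ≠ 0 := by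
        rw [Path.extend_apply γ ht]
        exact hγ _
      exact (Matrix.mulVec_injective_of_det_ne_zero hdet).comp hΦ

end ComplexLines

section FramedComplexLines

variable {U : Type*} [AddCommGroup U] [Module ℝ U]

/-- The real-linear identification of `ℂ × ℂ` with `V4` determined by a frame and a basis. -/
def frameMap (a b : U →ₗ[ℝ] V4) (e₁ e₂ : U) : ℂ × ℂ →ₗ[ℝ] V4 where
  toFun q := q.1.re • a e₁ + q.1.im • a e₂ + (q.2.re • b e₁ + q.2.im • b e₂)
  map_add' q q' := by
    simp only [Prod.fst_add, Prod.snd_add, Complex.add_re, Complex.add_im]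
    module
  map_smul' r q := by
    simp only [Prod.smul_fst, Prod.smul_snd, Complex.smul_re, Complex.smul_im, smul_eq_mul,
      RingHom.id_apply]
    module

theorem frameMap_apply (a b : U →ₗ[ℝ] V4) (e₁ e₂ : U) (q : ℂ × ℂ) :
    frameMap a b e₁ e₂ q =
      q.1.re • a e₁ + q.1.im • a e₂ + (q.2.re • b e₁ + q.2.im • b e₂) := rfl

variable {a b : U →ₗ[ℝ] V4} {e₁ e₂ : U}

theorem frameMap_injective (h : IsFrame a b) (he : LinearIndependent ℝ ![e₁, e₂]) :
    Function.Injective (frameMap a b e₁ e₂) := by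
  rw [injective_iff_map_eq_zero]
  intro q hq
  obtain ⟨h1, h2, h3, h4⟩ := h.eq_zero he hq
  exact Prod.ext (Complex.ext h1 h2) (Complex.ext h3 h4)

theorem range_eq_complexLine (hU : Module.finrank ℝ U = 2)
    (he : LinearIndependent ℝ ![e₁, e₂]) :
    LinearMap.range b = complexLine (frameMap a b e₁ e₂) (0, 1) := by
  rw [range_eq_span_pair hU he, complexLine]
  simp [frameMap_apply]

theorem graphLine_eq_complexLine (hU : Module.finrank ℝ U = 2)
    (he : LinearIndependent ℝ ![e₁, e₂]) {X : U →ₗ[ℝ] U} {r t : ℝ}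
    (h₁ : X e₁ = r • e₁ + t • e₂) (h₂ : X e₂ = (-t) • e₁ + r • e₂) :
    graphLine a b X = complexLine (frameMap a b e₁ e₂) (1, ⟨r, t⟩) := by
  rw [graphLine, range_eq_span_pair hU he, complexLine]
  simp [frameMap_apply, h₁, h₂]

theorem FramedLines.coarseDeformEquiv {A C : U →ₗ[ℝ] U} {L : Fin 5 → PLine}
    (hf : FramedLines a b A C L) (hL : PairwiseSkew L) (hU : Module.finrank ℝ U = 2)
    (he : LinearIndependent ℝ ![e₁, e₂]) {p ω r t : ℝ}
    (hA₁ : A e₁ = p • e₁ + ω • e₂) (hA₂ : A e₂ = (-ω) • e₁ + p • e₂)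
    (hC₁ : C e₁ = r • e₁ + t • e₂) (hC₂ : C e₂ = (-t) • e₁ + r • e₂) :
    CoarseDeformEquiv L (joinConfig (Equiv.refl (Fin 5))) := by
  have hline : L = fun i => complexLine (frameMap a b e₁ e₂)
      ((![(1, ⟨0, 0⟩), (0, 1), (1, ⟨1, 0⟩), (1, ⟨p, ω⟩), (1, ⟨r, t⟩)] : Fin 5 → ℂ × ℂ) i) := by
    funext i
    fin_cases i
    · exact hf.eq₀.trans (graphLine_eq_complexLine hU he (by simp) (by simp))
    · exact hf.eq₁.trans (range_eq_complexLine hU he)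
    · exact hf.eq₂.trans (graphLine_eq_complexLine hU he (by simp) (by simp))
    · exact hf.eq₃.trans (graphLine_eq_complexLine hU he hA₁ hA₂)
    · exact hf.eq₄.trans (graphLine_eq_complexLine hU he hC₁ hC₂)
  rw [hline] at hL ⊢
  refine coarseDeformEquiv_joinConfig (frameMap_injective hf.isFrame he) (fun i => ?_) hL
  fin_cases i <;> simp

end FramedComplexLines

theorem cubic_F2_five_skew_lines (F : MvPolynomial (Fin 4) ℝ) (hF0 : F ≠ 0)
    (hFhom : F.IsHomogeneous 3)
    (hns : ∀ z : Fin 4 → ℂ, z ≠ 0 →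
      MvPolynomial.eval z (MvPolynomial.map (algebraMap ℝ ℂ) F) = 0 →
      ∃ j : Fin 4, MvPolynomial.eval z
        (MvPolynomial.map (algebraMap ℝ ℂ) (MvPolynomial.pderiv j F)) ≠ 0)
    (h15 : {P : PLine | IsLine P ∧ ∀ x ∈ P, MvPolynomial.eval x F = 0}.ncard = 15)
    (L : Fin 5 → PLine) (hL : PairwiseSkew L)
    (hLF : ∀ i : Fin 5, ∀ x ∈ L i, MvPolynomial.eval x F = 0) :
    CoarseDeformEquiv L (joinConfig (Equiv.refl (Fin 5))) := by
  have hon : ∀ P : PLine, LiesOn (polarForm F) P ↔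
      IsLine P ∧ ∀ x ∈ P, MvPolynomial.eval x F = 0 := fun P => by
    simp [LiesOn, polarForm_self hFhom]
  have hline : ∀ i, IsLine (L i) := fun i => by
    obtain ⟨j, hj⟩ := exists_ne i
    exact (hL i j hj.symm).1
  simp only [← hon] at h15
  obtain ⟨a, b, A, C, hf⟩ := exists_framedLines hL
  obtain ⟨e₁, e₂, he, p, ω, r, t, ⟨hA₁, hA₂⟩, hC₁, hC₂⟩ :=
    exists_complex_basis (nonsingular_polarForm hFhom hns) h15 (hline 0) hL
      (fun i => (hon _).2 ⟨hline i, hLF i⟩) hf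
  exact hf.coarseDeformEquiv hL (hline 0) he hA₁ hA₂ hC₁ hC₂
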